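/- Let k be an integer with k ≥ 2 and let n ≥ 3 be divisible by k. For every balanced k-partite graph G on n vertices, if the minimum degree of G satisfies δ(G) ≥ ⌈n/2⌉ + ⌊(n+2)/(2·⌈(k+1)/2⌉)⌋ − n/k, then G has a Hamiltonian cycle, unless (k = 2 and 4 divides n) or (k = n/2 and 4 divides n). -/

import Mathlib

open SimpleGraph Finset

/-- `G` is a balanced `k`-partite graph: the vertex set can be partitioned into `k` parts,
each of size `|V|/k`, such that every edge joins vertices in different parts. -/
def IsBalancedKPartite {V : Type*} [Fintype V] [DecidableEq V]
    (G : SimpleGraph V) (k : ℕ) : Prop :=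
  ∃ P : V → Fin k,
    (∀ i : Fin k, (Finset.univ.filter fun v => P v = i).card = Fintype.card V / k) ∧
    (∀ u v : V, G.Adj u v → P u ≠ P v)

/-- The degree bound `⌈n/2⌉ + ⌊(n+2)/(2⌈(k+1)/2⌉)⌋ − n/k`, as a rational number. -/
def degBound (n k : ℕ) : ℚ :=
  (⌈(n : ℚ) / 2⌉ : ℚ) + (⌊((n : ℚ) + 2) / (2 * (⌈((k : ℚ) + 1) / 2⌉ : ℚ))⌋ : ℚ) - (n : ℚ) / k

/-- `PathOn G a b S`: there is a path of `G` from `a` to `b` whose vertex set is exactly `S`. -/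
inductive PathOn {V : Type*} [DecidableEq V] (G : SimpleGraph V) : V → V → Finset V → Prop
  | single (a : V) : PathOn G a a {a}
  | cons {a b c : V} {S : Finset V} (h : G.Adj a b) (p : PathOn G b c S) (ha : a ∉ S) :
      PathOn G a c (insert a S)

/-- `F : ℤ → V` winds around a closed walk of `G` on `c` distinct vertices. -/
def IsCyc {V : Type*} (G : SimpleGraph V) (c : ℕ) (F : ℤ → V) : Prop :=
  (∀ i, G.Adj (F i) (F (i + 1))) ∧ ∀ i j, F i = F j ↔ (c : ℤ) ∣ i - j

namespace PathOn

variable {V : Type*} [DecidableEq V] {G : SimpleGraph V}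

theorem left_mem {a b : V} {S : Finset V} (p : PathOn G a b S) : a ∈ S := by
  cases p <;> simp

theorem right_mem {a b : V} {S : Finset V} (p : PathOn G a b S) : b ∈ S := by
  induction p <;> simp_all

theorem append {a b c d : V} {S S' : Finset V} (p : PathOn G a b S) (h : G.Adj b c)
    (q : PathOn G c d S') (hd : Disjoint S S') : PathOn G a d (S ∪ S') := by
  induction p with
  | single a =>
    rw [← insert_eq]
    exact cons h q (by simpa using hd)
  | @cons a b' c' S h' p ha ih =>
    rw [insert_union]
    rw [disjoint_insert_left] at hd
    exact cons h' (ih h hd.2) (by simp [ha, hd.1])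

theorem symm {a b : V} {S : Finset V} (p : PathOn G a b S) : PathOn G b a S := by
  induction p with
  | single a => exact single a
  | @cons a b' c' S h p ha ih =>
    rw [insert_eq, union_comm]
    exact ih.append h.symm (single a) (by simpa using ha)

theorem snoc {a b c : V} {S : Finset V} (p : PathOn G a b S) (h : G.Adj b c) (hc : c ∉ S) :
    PathOn G a c (insert c S) := by
  rw [insert_eq, union_comm]
  exact p.append h (single c) (by simpa using hc)

theorem map {W : Type*} [DecidableEq W] {H : SimpleGraph W} (g : V → W)
    (hg : ∀ x y, G.Adj x y → H.Adj (g x) (g y)) {a b : V} {S : Finset V} (p : PathOn G a b S)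
    (hinj : Set.InjOn g S) : PathOn H (g a) (g b) (S.image g) := by
  induction p with
  | single a => simpa using single (g a)
  | @cons a b' c' S h p ha ih =>
    rw [image_insert]
    refine cons (hg _ _ h) (ih (hinj.mono (by simp))) ?_
    rw [mem_image]
    rintro ⟨y, hy, hya⟩
    have : y = a := hinj (by simp [hy]) (by simp) hya
    exact ha (this ▸ hy)

theorem exists_suffix {a b x : V} {S : Finset V} (p : PathOn G a b S) (hx : x ∈ S) :
    ∃ S' ⊆ S, PathOn G x b S' := by
  induction p with
  | single a =>
    rw [mem_singleton] at hx
    exact ⟨_, subset_rfl, hx ▸ single _⟩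
  | @cons a b' c' S h p ha ih =>
    rcases mem_insert.1 hx with rfl | hx
    · exact ⟨_, subset_rfl, cons h p ha⟩
    · obtain ⟨S', hS, q⟩ := ih hx
      exact ⟨S', hS.trans (subset_insert _ _), q⟩

theorem trans {a b c : V} {S S' : Finset V} (p : PathOn G a b S) (q : PathOn G b c S') :
    ∃ S'' ⊆ S ∪ S', PathOn G a c S'' := by
  induction p with
  | single a => exact ⟨S', subset_union_right, q⟩
  | @cons a b' c' S h p ha ih =>
    obtain ⟨S'', hS, r⟩ := ih q
    by_cases h' : a ∈ S''
    · obtain ⟨S₀, h₀, r₀⟩ := r.exists_suffix h'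
      refine ⟨S₀, (h₀.trans hS).trans ?_, r₀⟩
      exact union_subset_union_left (subset_insert _ _)
    · refine ⟨insert a S'', ?_, cons h r h'⟩
      rw [insert_union]
      exact insert_subset_insert _ hS

theorem exists_enum {a b : V} {S : Finset V} (p : PathOn G a b S) :
    ∃ f : ℕ → V, f 0 = a ∧ f (S.card - 1) = b ∧ (∀ i, i + 1 < S.card → G.Adj (f i) (f (i + 1))) ∧
      Set.InjOn f (Set.Iio S.card) ∧ (∀ i < S.card, f i ∈ S) ∧ ∀ x ∈ S, ∃ i < S.card, f i = x := by
  induction p with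
  | single a => exact ⟨fun _ => a, by simp⟩
  | @cons a b' c' S h p ha ih =>
    obtain ⟨f, h0, h1, hadj, hinj, hmem, hsurj⟩ := ih
    have hpos : 0 < S.card := card_pos.2 ⟨_, p.left_mem⟩
    rw [card_insert_of_notMem ha]
    refine ⟨fun i => Nat.casesOn i a f, rfl, ?_, ?_, ?_, ?_, ?_⟩
    · obtain ⟨m, hm⟩ := Nat.exists_eq_succ_of_ne_zero hpos.ne'
      rw [hm] at h1 ⊢
      simpa using h1
    · rintro (_ | i) hi
      · simpa [h0] using h
      · exact hadj i (by omega)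
    · rintro (_ | i) hi (_ | j) hj hij
      · rfl
      · exact absurd (show a ∈ S from (show a = f j from hij) ▸ hmem j (by simpa using hj)) ha
      · exact absurd (show a ∈ S from (show f i = a from hij) ▸ hmem i (by simpa using hi)) ha
      · exact congrArg _ (hinj (by simpa using hi) (by simpa using hj) hij)
    · rintro (_ | i) hi
      · simp
      · exact mem_insert_of_mem (hmem i (by omega))
    · intro x hx
      rcases mem_insert.1 hx with rfl | hx
      · exact ⟨0, by omega, rfl⟩
      · obtain ⟨i, hi, rfl⟩ := hsurj x hx
        exact ⟨i + 1, by omega, rfl⟩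

theorem exists_isCyc {a b : V} {S : Finset V} (p : PathOn G a b S) (h : G.Adj b a) :
    ∃ F, IsCyc G S.card F ∧ ∀ i, F i ∈ S := by
  obtain ⟨f, h0, h1, hadj, hinj, hmem, -⟩ := p.exists_enum
  have hpos : 0 < S.card := card_pos.2 ⟨_, p.left_mem⟩
  have hlt : ∀ i : ℤ, (i % S.card).toNat < S.card := fun i => by
    have := Int.emod_lt_of_pos i (show (0 : ℤ) < S.card by omega)
    omega
  have hnn : ∀ i : ℤ, 0 ≤ i % (S.card : ℤ) := fun i => Int.emod_nonneg i (by omega)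
  refine ⟨fun i => f (i % S.card).toNat, ⟨fun i => ?_, fun i j => ?_⟩, fun i => hmem _ (hlt i)⟩
  · by_cases hi : (i % S.card).toNat + 1 < S.card
    · have : ((i + 1) % S.card).toNat = (i % S.card).toNat + 1 := by
        rw [Int.add_emod_eq_add_emod_right 1 (Int.emod_emod_of_dvd i dvd_rfl).symm,
          Int.emod_eq_of_lt] <;> have := hnn i <;> omega
      simp only [this]
      exact hadj _ hi
    · have h2 : (i % S.card).toNat = S.card - 1 := by have := hlt i; omega
      have h3 : ((i + 1) % S.card).toNat = 0 := by
        rw [Int.add_emod_eq_add_emod_right 1 (Int.emod_emod_of_dvd i dvd_rfl).symm]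
        have : i % S.card + 1 = S.card := by have := hnn i; omega
        rw [this]; simp
      simp only [h2, h3, h0, h1]
      exact h
  · rw [← Int.emod_eq_emod_iff_emod_sub_eq_zero.trans (Int.dvd_iff_emod_eq_zero).symm]
    constructor
    · intro hij
      have := hinj (hlt i) (hlt j) hij
      have := hnn i
      have := hnn j
      omega
    · intro hij
      simp only [hij]

theorem exists_walk {a b : V} {S : Finset V} (p : PathOn G a b S) :
    ∃ w : G.Walk a b, w.IsPath ∧ w.length + 1 = S.card ∧ ∀ x, x ∈ w.support ↔ x ∈ S := by
  induction p with
  | single a => exact ⟨.nil, by simp⟩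
  | @cons a b' c' S h p ha ih =>
    obtain ⟨w, hw, hl, hs⟩ := ih
    refine ⟨.cons h w, by simp [hw, hs, ha], by simp [hl, ha], by simp [hs]⟩

end PathOn

theorem PathOn.Icc_of_lt {H : SimpleGraph ℤ} {i j : ℤ} (hij : i ≤ j)
    (hH : ∀ x, i ≤ x → x < j → H.Adj x (x + 1)) : PathOn H i j (Icc i j) := by
  obtain ⟨m, rfl⟩ : ∃ m : ℕ, j = i + m := ⟨(j - i).toNat, by omega⟩
  clear hij
  induction m with
  | zero => simpa using PathOn.single i
  | succ m ih =>
    have h := (ih fun x h1 h2 => hH x h1 (by omega)).snoc (c := i + (m + 1 : ℕ)) (by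
      have := hH (i + m) (by omega) (by omega); rwa [add_assoc] at this) (by simp)
    convert h using 2
    ext x; simp only [mem_Icc, mem_insert]; omega

theorem PathOn.Icc {H : SimpleGraph ℤ} (hH : ∀ i, H.Adj i (i + 1)) {i j : ℤ} (hij : i ≤ j) :
    PathOn H i j (Icc i j) :=
  PathOn.Icc_of_lt hij fun x _ _ => hH x

theorem PathOn.isHamiltonian {V : Type*} [Fintype V] [DecidableEq V] {G : SimpleGraph V} {a b : V}
    (p : PathOn G a b univ) (h : G.Adj b a) (hV : 3 ≤ Fintype.card V) : G.IsHamiltonian := by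
  obtain ⟨w, hw, hl, -⟩ := p.exists_walk
  rw [card_univ] at hl
  intro _
  refine ⟨b, .cons h w, ?_⟩
  rw [Walk.isHamiltonianCycle_iff_isCycle_and_length_eq]
  refine ⟨?_, by simpa using hl⟩
  rw [Walk.cons_isCycle_iff]
  refine ⟨hw, fun hmem => ?_⟩
  have h1 := hw.length_eq_one_of_mem_edges (by rwa [Sym2.eq_swap])
  omega

namespace IsCyc

variable {V : Type*} {G : SimpleGraph V} {c : ℕ} {F : ℤ → V}

theorem rotate (hF : IsCyc G c F) (a : ℤ) : IsCyc G c fun i => F (i + a) :=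
  ⟨fun i => by have := hF.1 (i + a); rwa [add_right_comm] at this, fun i j => by
    rw [hF.2]; ring_nf⟩

theorem reverse (hF : IsCyc G c F) : IsCyc G c fun i => F (-i) :=
  ⟨fun i => by have := (hF.1 (-(i + 1))).symm; rwa [show -(i + 1) + 1 = -i by ring] at this,
    fun i j => by rw [hF.2, ← dvd_neg]; ring_nf⟩

theorem add_period (hF : IsCyc G c F) (i : ℤ) : F (i + c) = F i := (hF.2 _ _).2 (by simp)

theorem injOn (hF : IsCyc G c F) (a : ℤ) : Set.InjOn F (Set.Ico a (a + c)) := by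
  intro i hi j hj hij
  obtain ⟨q, hq⟩ := (hF.2 i j).1 hij
  simp only [Set.mem_Ico] at hi hj
  have h1 : (c : ℤ) * q < c * 1 := by omega
  have h2 : (c : ℤ) * (-1) < c * q := by rw [mul_neg, mul_one]; omega
  have := lt_of_mul_lt_mul_left h1 (by omega)
  have := lt_of_mul_lt_mul_left h2 (by omega)
  have : q = 0 := by omega
  subst this
  omega

theorem period_pos [Finite V] (hF : IsCyc G c F) : 2 ≤ c := by
  rcases c with _ | _ | c
  · refine absurd (Finite.of_injective F fun i j h => ?_) (not_finite_iff_infinite.2 inferInstance)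
    have := (hF.2 i j).1 h
    simp only [Nat.cast_zero, zero_dvd_iff] at this
    omega
  · exact absurd ((hF.2 0 (0 + 1)).2 (by simp)) (hF.1 0).ne
  · omega

theorem card_image [DecidableEq V] (hF : IsCyc G c F) : ((Ico (0 : ℤ) c).image F).card = c := by
  rw [card_image_of_injOn]
  · simp
  · have := hF.injOn 0
    simpa using this

theorem exists_rep (hc : 0 < c) (hF : IsCyc G c F) (a i : ℤ) :
    ∃ j, a ≤ j ∧ j < a + c ∧ F j = F i := by
  have hc' : (0 : ℤ) < c := by omega
  refine ⟨a + (i - a) % c, ?_, ?_, ?_⟩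
  · have := Int.emod_nonneg (i - a) hc'.ne'; omega
  · have := Int.emod_lt_of_pos (i - a) hc'; omega
  · rw [hF.2]
    have := Int.emod_add_mul_ediv (i - a) c
    exact ⟨-((i - a) / c), by rw [mul_neg]; linarith⟩

theorem mem_image_iff [DecidableEq V] (hF : IsCyc G c F) (hc : 0 < c) {x : V} :
    x ∈ (Ico (0 : ℤ) c).image F ↔ ∃ i, F i = x := by
  rw [mem_image]
  constructor
  · rintro ⟨i, -, h⟩; exact ⟨i, h⟩
  · rintro ⟨i, rfl⟩
    obtain ⟨j, h1, h2, h3⟩ := hF.exists_rep hc 0 i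
    exact ⟨j, by simp; omega, h3⟩

end IsCyc

section Longest

variable {V : Type*} [DecidableEq V] {G : SimpleGraph V} {c : ℕ} {F : ℤ → V}

/-- A closed walk on `c` vertices and a path `S` off it cannot be spliced into something longer. -/
theorem IsCyc.card_add_card_le (hF : IsCyc G c F)
    (hmax : ∀ a b S, PathOn G a b S → G.Adj b a → S.card ≤ c) {i j a : ℤ} {x y : V} {A : Finset ℤ}
    {S : Finset V} (p : PathOn (G.comap F) i j A) (hA : A ⊆ Ico a (a + c)) (q : PathOn G x y S)
    (hS : ∀ s ∈ S, ∀ i, F i ≠ s) (h1 : G.Adj (F j) x) (h2 : G.Adj y (F i)) :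
    A.card + S.card ≤ c := by
  have hinj : Set.InjOn F A := (hF.injOn a).mono (by
    intro z hz
    simpa using hA hz)
  have hd : Disjoint (A.image F) S := by
    rw [disjoint_right]
    intro s hs hs'
    obtain ⟨z, -, hz⟩ := mem_image.1 hs'
    exact hS s hs z hz
  have := hmax _ _ _ ((p.map F (fun _ _ h => h) hinj).append h1 q hd) h2
  rwa [card_union_of_disjoint hd, card_image_of_injOn hinj] at this

theorem IsCyc.card_lt_of_adj (hF : IsCyc G c F)
    (hmax : ∀ a b S, PathOn G a b S → G.Adj b a → S.card ≤ c) {i l : ℤ} {x y : V}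
    {S : Finset V} (q : PathOn G x y S) (hS : ∀ s ∈ S, ∀ i, F i ≠ s) (hl : 1 ≤ l) (hlc : l ≤ c)
    (h1 : G.Adj (F i) x) (h2 : G.Adj y (F (i + l))) : (S.card : ℤ) < l := by
  have h := hF.card_add_card_le hmax (a := i + 1)
    (PathOn.Icc (H := G.comap F) hF.1 (show i + l ≤ i + c by omega)) (by
      intro z; simp only [mem_Icc, mem_Ico]; omega) q hS (by rwa [hF.add_period]) h2
  rw [Int.card_Icc] at h
  omega

theorem IsCyc.card_filter_image_eq (hF : IsCyc G c F) (P : V → Prop) [DecidablePred P] :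
    ((Ico (0 : ℤ) c).filter fun j => P (F j)).card = (((Ico (0 : ℤ) c).image F).filter P).card := by
  rw [filter_image, card_image_of_injOn]
  have := hF.injOn 0
  simp only [zero_add] at this
  exact this.mono (by intro z; simp; tauto)

theorem IsCyc.card_add_degree_le [Fintype V] [DecidableRel G.Adj] (hF : IsCyc G c F)
    (hmax : ∀ a b S, PathOn G a b S → G.Adj b a → S.card ≤ c) {D : Finset V}
    (hD : ∀ x ∈ D, ∀ i, F i ≠ x)
    (hpath : ∀ x ∈ D, ∀ y ∈ D, ∃ S, (∀ s ∈ S, ∀ i, F i ≠ s) ∧ S ⊆ D ∧ PathOn G x y S) {x y : V}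
    (hx : x ∈ D) (hy : y ∈ D) {m : ℤ} (hm : 0 ≤ m) (hmc : m < c - 1) (hxa : G.Adj (F (c - 1)) x)
    (hya : G.Adj (F m) y) :
    D.card + (G.degree (F 0) + G.degree (F (m + 1))) ≤ Fintype.card V := by
  classical
  have hc2 := hF.period_pos
  obtain ⟨S, hS, hSD, q⟩ := hpath x hx y hy
  have hSpos : 0 < S.card := card_pos.2 ⟨_, q.left_mem⟩
  have h0D : ∀ z ∈ D, ¬ G.Adj (F 0) z := by
    intro z hz h
    obtain ⟨S', hS', -, q'⟩ := hpath x hx z hz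
    have := hF.card_lt_of_adj hmax q' hS' le_rfl (by omega) hxa (l := 1)
      (by rw [show (c : ℤ) - 1 + 1 = 0 + c by ring, hF.add_period]; exact h.symm)
    have : 0 < S'.card := card_pos.2 ⟨_, q'.left_mem⟩
    omega
  have h1D : ∀ z ∈ D, ¬ G.Adj (F (m + 1)) z := by
    intro z hz h
    obtain ⟨S', hS', -, q'⟩ := hpath y hy z hz
    have := hF.card_lt_of_adj hmax q' hS' le_rfl (by omega) hya h.symm
    have : 0 < S'.card := card_pos.2 ⟨_, q'.left_mem⟩
    omega
  have hadj : ∀ i, (G.comap F).Adj i (i + 1) := hF.1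
  set C := (Ico (0 : ℤ) c).image F with hC
  have hCcard : C.card = c := hF.card_image
  -- no common neighbour off the cycle
  have hcommon : ∀ z, z ∉ C → G.Adj (F 0) z → G.Adj (F (m + 1)) z → False := by
    intro z hz h0 h1
    have hzF : ∀ i, F i ≠ z := by
      intro i hi
      exact hz ((hF.mem_image_iff (by omega)).2 ⟨i, hi⟩)
    have hzD : z ∉ D := fun h => h0D z h h0
    have hinj : ∀ A : Finset ℤ, A ⊆ Ico 0 (c : ℤ) → Set.InjOn F A := by
      intro A hA
      have := hF.injOn 0
      simp only [zero_add] at this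
      refine this.mono ?_
      intro i hi
      simpa using hA hi
    have p1 := (PathOn.Icc hadj (show m + 1 ≤ (c : ℤ) - 1 by omega)).map F (fun _ _ h => h)
      (hinj _ (by intro i; simp only [mem_Icc, mem_Ico]; omega))
    have p2 := (PathOn.Icc hadj hm).map F (fun _ _ h => h)
      (hinj _ (by intro i; simp only [mem_Icc, mem_Ico]; omega))
    have hdS : ∀ A : Finset ℤ, Disjoint (A.image F) S := by
      intro A
      rw [disjoint_right]
      intro s hs hs'
      obtain ⟨z, -, hz⟩ := mem_image.1 hs'
      exact hS s hs z hz
    have hd : Disjoint ((Icc (m + 1) ((c : ℤ) - 1)).image F ∪ S) ((Icc 0 m).image F) := by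
      rw [disjoint_union_left]
      refine ⟨?_, (hdS _).symm⟩
      rw [Finset.disjoint_left]
      intro u hu hu'
      obtain ⟨i, hi, rfl⟩ := mem_image.1 hu
      obtain ⟨j, hj, hij⟩ := mem_image.1 hu'
      rw [mem_Icc] at hi hj
      have := hinj (Ico 0 c) subset_rfl (by simp; omega) (by simp; omega) hij
      omega
    have p3 := (p1.append hxa q (hdS _)).append hya.symm p2.symm hd
    have hnot : z ∉ (Icc (m + 1) ((c : ℤ) - 1)).image F ∪ S ∪ (Icc 0 m).image F := by
      simp only [mem_union, mem_image, not_or]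
      exact ⟨⟨fun ⟨i, _, h⟩ => hzF i h, fun h => hzD (hSD h)⟩, fun ⟨i, _, h⟩ => hzF i h⟩
    have := hmax _ _ _ (p3.snoc h0 hnot) h1.symm
    rw [card_insert_of_notMem hnot, card_union_of_disjoint hd, card_union_of_disjoint (hdS _),
      card_image_of_injOn (hinj _ (by intro i; simp only [mem_Icc, mem_Ico]; omega)),
      card_image_of_injOn (hinj _ (by intro i; simp only [mem_Icc, mem_Ico]; omega)),
      Int.card_Icc, Int.card_Icc] at this
    omega
  -- no crossing pair of chords
  have hcross : ∀ i j : ℤ, PathOn (G.comap F) i j (Ico 0 c) → j = c - 1 → i = m → False := by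
    rintro i j p rfl rfl
    have := hF.card_add_card_le hmax (a := 0) p (by simp) q hS hxa hya.symm
    simp only [Int.card_Ico] at this
    omega
  have hcross1 : ∀ j, 0 < j → j ≤ m → G.Adj (F 0) (F j) → ¬ G.Adj (F (m + 1)) (F (j - 1)) := by
    intro j hj0 hjm h0 h1
    have p1 := PathOn.Icc hadj (show m + 1 ≤ (c : ℤ) - 1 by omega)
    have p2 := PathOn.Icc hadj (show 0 ≤ j - 1 by omega)
    have p3 := PathOn.Icc hadj hjm
    have p := (p1.symm.append h1 p2.symm (by
      rw [Finset.disjoint_left]; intro z; simp only [mem_Icc]; omega)).append h0 p3 (by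
      rw [Finset.disjoint_left]; intro z; simp only [mem_Icc, mem_union]; omega)
    refine hcross _ _ (by convert p.symm using 1; ext z; simp; omega) rfl rfl
  have hcross2 : ∀ j, m < j → j < c - 1 → G.Adj (F 0) (F j) → ¬ G.Adj (F (m + 1)) (F (j + 1)) := by
    intro j hj0 hjm h0 h1
    have p1 := PathOn.Icc hadj (show j + 1 ≤ (c : ℤ) - 1 by omega)
    have p2 := PathOn.Icc hadj (show m + 1 ≤ j by omega)
    have p3 := PathOn.Icc hadj hm
    have p := (p1.symm.append h1.symm p2 (by
      rw [Finset.disjoint_left]; intro z; simp only [mem_Icc]; omega)).append h0.symm p3 (by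
      rw [Finset.disjoint_left]; intro z; simp only [mem_Icc, mem_union]; omega)
    refine hcross _ _ (by convert p.symm using 1; ext z; simp; omega) rfl rfl
  -- neighbours on the cycle
  set J₀ := (Ico (0 : ℤ) c).filter fun j => G.Adj (F 0) (F j) with hJ₀
  set J₁ := (Ico (0 : ℤ) c).filter fun j => G.Adj (F (m + 1)) (F j) with hJ₁
  have hJ : J₀.card + J₁.card ≤ c := by
    have hsub : (J₀.erase (c - 1)).image (fun j => if j ≤ m then j - 1 else j + 1) ∪
        insert (m + 1) J₁ ⊆ Ico (0 : ℤ) c := by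
      intro z hz
      simp only [mem_union, mem_image, mem_erase, mem_insert, hJ₀, hJ₁, mem_filter, mem_Ico] at hz ⊢
      rcases hz with ⟨j, ⟨hj, ⟨hj0, hjc⟩, hja⟩, rfl⟩ | rfl | hz
      · have : j ≠ 0 := by rintro rfl; exact hja.ne rfl
        split_ifs <;> omega
      · omega
      · exact hz.1
    have hdis : Disjoint ((J₀.erase (c - 1)).image (fun j => if j ≤ m then j - 1 else j + 1))
        (insert (m + 1) J₁) := by
      rw [Finset.disjoint_left]
      intro z hz hz'
      simp only [mem_image, mem_erase, mem_insert, hJ₀, hJ₁, mem_filter, mem_Ico] at hz hz'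
      obtain ⟨j, ⟨hj, ⟨hj0, hjc⟩, hja⟩, rfl⟩ := hz
      have : j ≠ 0 := by rintro rfl; exact hja.ne rfl
      rcases hz' with hz' | ⟨-, hz'⟩
      · split_ifs at hz' <;> omega
      · split_ifs at hz' with h
        · exact hcross1 j (by omega) h hja hz'
        · exact hcross2 j (by omega) (by omega) hja hz'
    have h1 := card_le_card hsub
    rw [card_union_of_disjoint hdis, card_insert_of_notMem (by simp [hJ₁]), card_image_of_injOn,
      Int.card_Ico] at h1
    · have := pred_card_le_card_erase (s := J₀) (a := (c : ℤ) - 1)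
      omega
    · intro j hj j' hj' h
      simp only at h
      split_ifs at h <;> omega
  rw [hJ₀, hJ₁, hF.card_filter_image_eq fun u => G.Adj (F 0) u,
    hF.card_filter_image_eq fun u => G.Adj (F (m + 1)) u, ← hC] at hJ
  have hdeg : ∀ v, G.degree v = (C.filter fun u => G.Adj v u).card +
      ((univ \ C).filter fun u => G.Adj v u).card := by
    intro v
    rw [← G.card_neighborFinset_eq_degree, neighborFinset_eq_filter, ← card_union_of_disjoint,
      ← filter_union, union_sdiff_of_subset (subset_univ C)]
    exact disjoint_filter_filter disjoint_sdiff
  have hout : ((univ \ C).filter fun u => G.Adj (F 0) u).card +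
      ((univ \ C).filter fun u => G.Adj (F (m + 1)) u).card + D.card + c ≤ Fintype.card V := by
    rw [← card_union_of_disjoint, ← card_union_of_disjoint, ← hCcard, ← card_union_of_disjoint]
    · exact card_le_univ _
    · rw [disjoint_right]
      intro u hu
      simp only [mem_union, mem_filter, mem_sdiff, hu, not_true, and_false, false_and, false_or]
      intro h
      obtain ⟨i, -, hi⟩ := mem_image.1 hu
      exact hD u h i hi
    · rw [Finset.disjoint_left]
      intro u hu huD
      simp only [mem_union, mem_filter, mem_sdiff] at hu
      rcases hu with h | h
      · exact h0D u huD h.2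
      · exact h1D u huD h.2
    · rw [Finset.disjoint_left]
      intro u hu hu'
      simp only [mem_filter, mem_sdiff] at hu hu'
      exact hcommon u hu.1.2 hu.2 hu'.2
  rw [hdeg (F 0), hdeg (F (m + 1))]
  omega

/-- Two vertices off a longest cycle lying in the same component have small component. -/
theorem IsCyc.card_add_two_mul_le [Fintype V] [DecidableRel G.Adj] (hF : IsCyc G c F)
    (hmax : ∀ a b S, PathOn G a b S → G.Adj b a → S.card ≤ c)
    (hconn : ∀ (D : Finset V) (z : V), z ∉ D → D.Nonempty → (∃ x, x ∉ D ∧ x ≠ z) →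
      ∃ a ∈ D, ∃ b, b ∉ D ∧ b ≠ z ∧ G.Adj a b) {δ : ℕ} (hδ : ∀ v, δ ≤ G.degree v)
    {w w' : V} {S₀ : Finset V} (q₀ : PathOn G w w' S₀) (hS₀ : ∀ s ∈ S₀, ∀ i, F i ≠ s) :
    S₀.card + 2 * δ ≤ Fintype.card V := by
  classical
  have hc2 := hF.period_pos
  set D : Finset V := univ.filter fun x => ∃ S, (∀ s ∈ S, ∀ i, F i ≠ s) ∧ PathOn G w x S with hD
  have hDF : ∀ x ∈ D, ∀ i, F i ≠ x := by
    intro x hx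
    obtain ⟨S, hS, q⟩ := (mem_filter.1 hx).2
    exact hS _ q.right_mem
  have hDclosed : ∀ x ∈ D, ∀ y, (∀ i, F i ≠ y) → G.Adj x y → y ∈ D := by
    intro x hx y hy hxy
    obtain ⟨S, hS, q⟩ := (mem_filter.1 hx).2
    have hxF := hDF x hx
    obtain ⟨S', hS', q'⟩ := q.trans (PathOn.cons hxy (PathOn.single y) (by simpa using hxy.ne))
    refine mem_filter.2 ⟨mem_univ _, S', fun s hs => ?_, q'⟩
    have := hS' hs
    simp only [mem_union, mem_insert, mem_singleton] at this
    rcases this with h | rfl | rfl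
    · exact hS s h
    · exact hxF
    · exact hy
  have hDpath : ∀ x ∈ D, ∀ y ∈ D, ∃ S, (∀ s ∈ S, ∀ i, F i ≠ s) ∧ S ⊆ D ∧ PathOn G x y S := by
    intro x hx y hy
    obtain ⟨S, hS, q⟩ := (mem_filter.1 hx).2
    obtain ⟨S', hS', q'⟩ := (mem_filter.1 hy).2
    obtain ⟨S'', hS'', q''⟩ := q.symm.trans q'
    have hav : ∀ s ∈ S'', ∀ i, F i ≠ s := fun s hs => by
      rcases mem_union.1 (hS'' hs) with h | h
      · exact hS s h
      · exact hS' s h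
    refine ⟨S'', hav, fun s hs => ?_, q''⟩
    obtain ⟨T, hT, r⟩ := q''.symm.exists_suffix hs
    obtain ⟨T', hT', r'⟩ := q.trans r.symm
    refine mem_filter.2 ⟨mem_univ _, T', fun s hs => ?_, r'⟩
    rcases mem_union.1 (hT' hs) with h | h
    · exact hS s h
    · exact hav s (hT h)
  have hS₀D : S₀ ⊆ D := by
    intro s hs
    obtain ⟨S', hS', q'⟩ := q₀.symm.exists_suffix hs
    exact mem_filter.2 ⟨mem_univ _, S', fun s' hs' => hS₀ s' (hS' hs'), q'.symm⟩
  have hDne : D.Nonempty := ⟨w, hS₀D q₀.left_mem⟩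
  have hFD : ∀ i, F i ∉ D := fun i hi => hDF _ hi i rfl
  have hnotD : ∀ x, x ∉ D → ∀ y ∈ D, G.Adj y x → ∃ i, F i = x := by
    intro x hx y hy hyx
    by_contra! h
    exact hx (hDclosed y hy x h hyx)
  obtain ⟨x, hxD, b, hbD, -, hxb⟩ := hconn D (F 0) (hFD 0) hDne ⟨F 1, hFD 1, (hF.1 0).ne'⟩
  obtain ⟨i₁, rfl⟩ := hnotD b hbD x hxD hxb
  obtain ⟨y, hyD, b, hbD, hne, hyb⟩ := hconn D (F i₁) (hFD _) hDne
    ⟨F (i₁ + 1), hFD _, (hF.1 i₁).ne'⟩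
  obtain ⟨i₂, rfl⟩ := hnotD b hbD y hyD hyb
  obtain ⟨m, hm0, hmc, hm⟩ := (hF.rotate (i₁ + 1)).exists_rep (by omega) 0 (i₂ - (i₁ + 1))
  simp only [sub_add_cancel] at hm
  rw [← hm] at hne hyb
  have hlast : F ((c : ℤ) - 1 + (i₁ + 1)) = F i₁ := (hF.2 _ _).2 (by ring_nf; simp)
  have hmne : m ≠ c - 1 := by
    rintro rfl
    exact hne hlast
  have h := (hF.rotate (i₁ + 1)).card_add_degree_le hmax (D := D) (fun x hx i => hDF x hx _)
    (fun x hx y hy => by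
      obtain ⟨S, hS, hSD, q⟩ := hDpath x hx y hy
      exact ⟨S, fun s hs i => hS s hs _, hSD, q⟩) hxD hyD hm0 (by omega)
    (by rw [hlast]; exact hxb.symm) hyb.symm
  have h1 := hδ (F (0 + (i₁ + 1)))
  have h2 := hδ (F (m + 1 + (i₁ + 1)))
  have h3 := card_le_card hS₀D
  omega

end Longest

section Shift

variable {V : Type*} [Fintype V] {G : SimpleGraph V} {c : ℕ} {F : ℤ → V}

open Classical in
/-- The set obtained by moving the vertices of `T` on the closed walk `F` by `s` steps. -/
noncomputable def shift (F : ℤ → V) (T : Finset V) (s : ℤ) : Finset V :=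
  univ.filter fun u => ∃ j, F j ∈ T ∧ F (j + s) = u

theorem mem_shift {T : Finset V} {s : ℤ} {u : V} :
    u ∈ shift F T s ↔ ∃ j, F j ∈ T ∧ F (j + s) = u := by
  simp [shift]

theorem IsCyc.apply_mem_shift (hF : IsCyc G c F) {T : Finset V} {s i : ℤ} :
    F i ∈ shift F T s ↔ F (i - s) ∈ T := by
  rw [mem_shift]
  constructor
  · rintro ⟨j, hj, hji⟩
    have : F (i - s) = F j := by
      rw [hF.2] at hji ⊢
      rw [← dvd_neg, show -(i - s - j) = j + s - i by ring]
      exact hji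
    rwa [this]
  · intro h
    exact ⟨i - s, h, by rw [sub_add_cancel]⟩

theorem IsCyc.card_shift (hF : IsCyc G c F) {T : Finset V} (hT : ∀ u ∈ T, ∃ i, F i = u) (s : ℤ) :
    (shift F T s).card = T.card := by
  classical
  have : ∀ u, ∃ i, u ∈ T → F i = u := fun u => by
    by_cases h : u ∈ T
    · exact (hT u h).imp fun i hi _ => hi
    · exact ⟨0, fun h' => absurd h' h⟩
  choose J hJ using this
  have hs : shift F T s = T.image fun u => F (J u + s) := by
    ext u
    simp only [mem_shift, mem_image]
    constructor
    · rintro ⟨j, hj, rfl⟩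
      refine ⟨F j, hj, ?_⟩
      have := hJ (F j) hj
      rw [hF.2] at this ⊢
      convert this using 1; ring
    · rintro ⟨v, hv, rfl⟩
      exact ⟨J v, by rwa [hJ v hv], rfl⟩
  rw [hs, card_image_of_injOn]
  intro u hu u' hu' h
  simp only at h
  rw [hF.2] at h
  rw [← hJ u hu, ← hJ u' hu', hF.2]
  convert h using 1; ring

end Shift

/-- A longest closed walk leaves an independent set of vertices. -/
theorem IsCyc.not_adj_of_longest {V : Type*} [Fintype V] [DecidableEq V] {G : SimpleGraph V}
    [DecidableRel G.Adj] {c : ℕ} {F : ℤ → V} (hF : IsCyc G c F)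
    (hmax : ∀ a b S, PathOn G a b S → G.Adj b a → S.card ≤ c)
    (hconn : ∀ (D : Finset V) (z : V), z ∉ D → D.Nonempty → (∃ x, x ∉ D ∧ x ≠ z) →
      ∃ a ∈ D, ∃ b, b ∉ D ∧ b ≠ z ∧ G.Adj a b) {δ : ℕ} (hδ : ∀ v, δ ≤ G.degree v)
    (h3 : Fintype.card V + 2 ≤ 3 * δ) (h10 : 4 * Fintype.card V < 10 * δ + 4) {x₀ y₀ : V}
    (hx₀ : ∀ i, F i ≠ x₀) (hy₀ : ∀ i, F i ≠ y₀) : ¬ G.Adj x₀ y₀ := by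
  classical
  intro hadj
  have hc2 := hF.period_pos
  -- a longest path off the closed walk
  obtain ⟨S, hSmem, hSmax⟩ := exists_max_image
    (univ.filter fun S : Finset V => (∀ s ∈ S, ∀ i, F i ≠ s) ∧ ∃ x y, PathOn G x y S)
    Finset.card ⟨{x₀, y₀}, by
      rw [mem_filter]
      refine ⟨mem_univ _, ?_, x₀, y₀, PathOn.cons hadj (PathOn.single _) (by simpa using hadj.ne)⟩
      simp only [mem_insert, mem_singleton, forall_eq_or_imp, forall_eq]
      exact ⟨hx₀, hy₀⟩⟩
  obtain ⟨hSF, x, y, q⟩ := (mem_filter.1 hSmem).2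
  have hp2 : 2 ≤ S.card := by
    have := hSmax {x₀, y₀} (by
      rw [mem_filter]
      refine ⟨mem_univ _, ?_, x₀, y₀, PathOn.cons hadj (PathOn.single _) (by simpa using hadj.ne)⟩
      simp only [mem_insert, mem_singleton, forall_eq_or_imp, forall_eq]
      exact ⟨hx₀, hy₀⟩)
    rwa [card_pair hadj.ne] at this
  have hpn := hF.card_add_two_mul_le hmax hconn hδ q hSF
  set C := (Ico (0 : ℤ) c).image F with hC
  have hCcard : C.card = c := hF.card_image
  have hCmem : ∀ z, z ∈ C ↔ ∃ i, F i = z := fun z => hF.mem_image_iff (by omega)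
  have hSC : Disjoint S C := by
    rw [Finset.disjoint_left]
    intro s hs hs'
    obtain ⟨i, hi⟩ := (hCmem s).1 hs'
    exact hSF s hs i hi
  have hSCcard : S.card + c ≤ Fintype.card V := by
    rw [← hCcard, ← card_union_of_disjoint hSC]
    exact card_le_univ _
  have hend : ∀ x y, PathOn G x y S → δ + 1 ≤ S.card + (C.filter fun u => G.Adj x u).card := by
    intro x y q
    have hsub : G.neighborFinset x ⊆ S.erase x ∪ C.filter fun u => G.Adj x u := by
      intro u hu
      rw [mem_neighborFinset] at hu
      rw [mem_union, mem_erase, mem_filter]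
      by_cases huS : u ∈ S
      · exact Or.inl ⟨hu.ne', huS⟩
      · refine Or.inr ⟨?_, hu⟩
        by_contra huC
        rw [hCmem, not_exists] at huC
        have := hSmax (insert u S) (by
          rw [mem_filter]
          refine ⟨mem_univ _, ?_, u, y, PathOn.cons hu.symm q huS⟩
          intro s hs
          rcases mem_insert.1 hs with rfl | hs
          · exact huC
          · exact hSF s hs)
        rw [card_insert_of_notMem huS] at this
        omega
    have h1 := card_le_card hsub
    have h2 := card_union_le (S.erase x) (C.filter fun u => G.Adj x u)
    rw [card_neighborFinset_eq_degree] at h1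
    rw [card_erase_of_mem q.left_mem] at h2
    have := hδ x
    omega
  set X := C.filter fun u => G.Adj x u with hX
  set Y := C.filter fun u => G.Adj y u with hY
  have hXc : δ + 1 ≤ S.card + X.card := hend x y q
  have hYc : δ + 1 ≤ S.card + Y.card := hend y x q.symm
  have hXC : X.card ≤ c := hCcard ▸ card_le_card (filter_subset _ _)
  have hc3 : 3 ≤ c := by omega
  have hUI : ∀ u ∈ X ∪ Y, ∃ i, F i = u := fun u hu => by
    rw [mem_union, hX, hY, mem_filter, mem_filter] at hu
    exact (hCmem u).1 (hu.elim And.left And.left)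
  have hII : ∀ u ∈ X ∩ Y, ∃ i, F i = u := fun u hu => by
    rw [mem_inter, hX, mem_filter] at hu
    exact (hCmem u).1 hu.1.1
  have hmemX : ∀ i, F i ∈ X → G.Adj x (F i) := fun i hi => (mem_filter.1 hi).2
  have hmemY : ∀ i, F i ∈ Y → G.Adj y (F i) := fun i hi => (mem_filter.1 hi).2
  have hone : ∀ i, F i ∈ X ∪ Y → F (i + 1) ∉ X ∪ Y := by
    intro i hi hi'
    have key : ∀ x y S, PathOn G x y S → (∀ s ∈ S, ∀ i, F i ≠ s) → G.Adj x (F i) →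
        ¬ G.Adj y (F (i + 1)) := by
      intro x y S q hS hx hy
      have := hF.card_lt_of_adj hmax q hS le_rfl (by omega) hx.symm hy
      have : 0 < S.card := card_pos.2 ⟨_, q.left_mem⟩
      omega
    have hsx : ∀ s ∈ ({x} : Finset V), ∀ i, F i ≠ s := by
      simpa using fun i => hSF x q.left_mem i
    have hsy : ∀ s ∈ ({y} : Finset V), ∀ i, F i ≠ s := by
      simpa using fun i => hSF y q.right_mem i
    rcases mem_union.1 hi with hi | hi <;> rcases mem_union.1 hi' with hi' | hi'
    · exact key _ _ _ (PathOn.single x) hsx (hmemX _ hi) (hmemX _ hi')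
    · exact key _ _ _ q hSF (hmemX _ hi) (hmemY _ hi')
    · exact key _ _ _ q.symm hSF (hmemY _ hi) (hmemX _ hi')
    · exact key _ _ _ (PathOn.single y) hsy (hmemY _ hi) (hmemY _ hi')
  have hfar : ∀ i l, F i ∈ X ∩ Y → F (i + l) ∈ X ∪ Y → 1 ≤ l → l ≤ c → (S.card : ℤ) < l := by
    intro i l hi hi' hl hlc
    rw [mem_inter] at hi
    rcases mem_union.1 hi' with hi' | hi'
    · exact hF.card_lt_of_adj hmax q.symm hSF hl hlc (hmemY _ hi.2).symm (hmemX _ hi')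
    · exact hF.card_lt_of_adj hmax q hSF hl hlc (hmemX _ hi.1).symm (hmemY _ hi')
  have hIU : X ∩ Y ⊆ X ∪ Y := inter_subset_left.trans subset_union_left
  have hshC : ∀ T s, shift F T s ⊆ C := fun T s u hu => by
    obtain ⟨j, -, rfl⟩ := mem_shift.1 hu
    exact (hCmem _).2 ⟨_, rfl⟩
  have hd01 : Disjoint (X ∪ Y) (shift F (X ∪ Y) 1) := by
    rw [Finset.disjoint_left]
    intro u hu hu'
    obtain ⟨i, rfl⟩ := hUI u hu
    rw [hF.apply_mem_shift] at hu'
    exact hone (i - 1) hu' (by rwa [sub_add_cancel])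
  have hd2 : Disjoint ((X ∪ Y) ∪ shift F (X ∪ Y) 1) (shift F (X ∩ Y) 2) := by
    rw [Finset.disjoint_right]
    intro u hu' hu
    obtain ⟨i, hi, rfl⟩ := mem_shift.1 hu'
    rw [mem_union, hF.apply_mem_shift] at hu
    rcases hu with hu | hu
    · have := hfar i 2 hi hu (by omega) (by omega)
      omega
    · rw [show i + 2 - 1 = i + 1 by ring] at hu
      exact hone i (hIU hi) hu
  have hsum := card_union_add_card_inter X Y
  have hUC : X ∪ Y ⊆ C := union_subset (filter_subset _ _) (filter_subset _ _)
  by_cases hp : S.card = 2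
  · have h := card_le_card (union_subset (union_subset hUC (hshC (X ∪ Y) 1)) (hshC (X ∩ Y) 2))
    rw [card_union_of_disjoint hd2, card_union_of_disjoint hd01, hF.card_shift hUI,
      hF.card_shift hII, hCcard] at h
    have := card_le_card (subset_union_left : X ⊆ X ∪ Y)
    omega
  · have hd3 : Disjoint ((X ∪ Y) ∪ shift F (X ∪ Y) 1 ∪ shift F (X ∩ Y) 2) (shift F (X ∩ Y) 3) := by
      rw [Finset.disjoint_right]
      intro u hu' hu
      obtain ⟨i, hi, rfl⟩ := mem_shift.1 hu'
      rw [mem_union, mem_union, hF.apply_mem_shift, hF.apply_mem_shift] at hu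
      rcases hu with (hu | hu) | hu
      · have := hfar i 3 hi hu (by omega) (by omega)
        omega
      · rw [show i + 3 - 1 = i + 2 by ring] at hu
        have := hfar i 2 hi hu (by omega) (by omega)
        omega
      · rw [show i + 3 - 2 = i + 1 by ring] at hu
        exact hone i (hIU hi) (hIU hu)
    have h := card_le_card (union_subset
      (union_subset (union_subset hUC (hshC (X ∪ Y) 1)) (hshC (X ∩ Y) 2)) (hshC (X ∩ Y) 3))
    rw [card_union_of_disjoint hd3, card_union_of_disjoint hd2, card_union_of_disjoint hd01,
      hF.card_shift hUI, hF.card_shift hII, hF.card_shift hII, hCcard] at h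
    omega

section Middle

variable {V : Type*} {G : SimpleGraph V} {c : ℕ} {F : ℤ → V} {v : V}

/-- `u` lies on `F` between two neighbours of `v`. -/
def Middle (G : SimpleGraph V) (F : ℤ → V) (v u : V) : Prop :=
  ∃ j, F j = u ∧ G.Adj v (F (j - 1)) ∧ G.Adj v (F (j + 1))

/-- `x` is adjacent to `v` or to a vertex of `F` between two neighbours of `v`. -/
def Attached (G : SimpleGraph V) (F : ℤ → V) (v x : V) : Prop :=
  G.Adj v x ∨ ∃ u, Middle G F v u ∧ G.Adj u x

theorem Middle.reverse {u : V} (h : Middle G F v u) : Middle G (fun i => F (-i)) v u := by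
  obtain ⟨j, h0, h1, h2⟩ := h
  refine ⟨-j, by simpa using h0, ?_, ?_⟩
  · convert h2 using 2; ring
  · convert h1 using 2; ring

theorem Attached.reverse {x : V} (h : Attached G F v x) : Attached G (fun i => F (-i)) v x :=
  h.imp_right fun ⟨u, hu, hux⟩ => ⟨u, hu.reverse, hux⟩

theorem IsCyc.middle_rep (hF : IsCyc G c F) (hc : 0 < c) (a : ℤ) {u : V} (h : Middle G F v u) :
    ∃ j, a ≤ j ∧ j < a + c ∧ F j = u ∧ G.Adj v (F (j - 1)) ∧ G.Adj v (F (j + 1)) := by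
  obtain ⟨j, rfl, h1, h2⟩ := h
  obtain ⟨i, hi, hi', hij⟩ := hF.exists_rep hc a j
  refine ⟨i, hi, hi', hij, ?_, ?_⟩
  · have : F (i - 1) = F (j - 1) := by
      rw [hF.2] at hij ⊢
      convert hij using 1; ring
    rwa [this]
  · have : F (i + 1) = F (j + 1) := by
      rw [hF.2] at hij ⊢
      convert hij using 1; ring
    rwa [this]

theorem PathOn.append' {H : SimpleGraph ℤ} {a b c d : ℤ} {S S' : Finset ℤ} (p : PathOn H a b S)
    (h : H.Adj b c) (q : PathOn H c d S') (hd : ∀ x ∈ S, x ∉ S') : PathOn H a d (S ∪ S') :=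
  p.append h q (Finset.disjoint_left.2 hd)

theorem IsCyc.not_insert [DecidableEq V] (hF : IsCyc G c F)
    (hmax : ∀ a b S, PathOn G a b S → G.Adj b a → S.card ≤ c) (hv : ∀ i, F i ≠ v) {a i j : ℤ}
    {A : Finset ℤ} (p : PathOn (G.comap F) i j A) (hA : A = Ico a (a + c)) (hi : G.Adj v (F i))
    (hj : G.Adj v (F j)) : False := by
  subst hA
  have := hF.card_add_card_le hmax p subset_rfl (PathOn.single v) (by simpa using hv) hj.symm hi
  simp at this

theorem IsCyc.not_attached_succ [Finite V] [DecidableEq V]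
    (hF : IsCyc G c F)
    (hmax : ∀ a b S, PathOn G a b S → G.Adj b a → S.card ≤ c) (hv : ∀ i, F i ≠ v) {a : ℤ}
    (h1 : Attached G F v (F (a + c - 1))) : ¬ Attached G F v (F a) := by
  intro h0
  have hc2 := hF.period_pos
  have hadj : ∀ i, (G.comap F).Adj i (i + 1) := hF.1
  have hwrap : F (a - 1) = F (a + c - 1) := by
    rw [← hF.add_period (a - 1)]; congr 1; ring
  have hwrap' : F (a + c - 1 + 1) = F a := by
    rw [← hF.add_period a]; congr 1; ring
  have hvv : G.Adj v (F (a + c - 1)) → ¬ G.Adj v (F a) := fun h1 h0 =>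
    hF.not_insert hmax hv (a := a) (PathOn.Icc hadj (show a ≤ a + c - 1 by omega))
      (by ext; simp) h0 h1
  have hvu : G.Adj v (F (a + c - 1)) → ¬ ∃ u, Middle G F v u ∧ G.Adj u (F a) := by
    rintro h1 ⟨u, hu, hua⟩
    obtain ⟨m, hm, hmc, rfl, hm1, hm2⟩ := hF.middle_rep (by omega) a hu
    have hma : m ≠ a := by rintro rfl; exact hua.ne rfl
    have hmc' : m ≠ a + c - 1 := by
      rintro rfl
      rw [hwrap'] at hm2
      exact hvv h1 hm2
    refine hF.not_insert hmax hv (a := a) ((PathOn.Icc hadj (show a ≤ m - 1 by omega)).symm.append'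
      hua.symm (PathOn.Icc hadj (show m ≤ a + c - 1 by omega)) ?_) ?_ hm1 h1
    · intro x; simp only [mem_Icc]; omega
    · ext x; simp; omega
  have huv : G.Adj v (F a) → ¬ ∃ u, Middle G F v u ∧ G.Adj u (F (a + c - 1)) := by
    rintro h1 ⟨u, hu, hua⟩
    obtain ⟨m, hm, hmc, rfl, hm1, hm2⟩ := hF.middle_rep (by omega) a hu
    have hma : m ≠ a + c - 1 := by rintro rfl; exact hua.ne rfl
    have hmc' : m ≠ a := by
      rintro rfl
      rw [hwrap] at hm1
      exact hvv hm1 h1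
    refine hF.not_insert hmax hv (a := a) ((PathOn.Icc hadj (show a ≤ m by omega)).append'
      hua (PathOn.Icc hadj (show m + 1 ≤ a + c - 1 by omega)).symm ?_) ?_ h1 hm2
    · intro x; simp only [mem_Icc]; omega
    · ext x; simp; omega
  rcases h1 with h1 | h1 <;> rcases h0 with h0 | h0
  · exact hvv h1 h0
  · exact hvu h1 h0
  · exact huv h0 h1
  have hn1 : ¬ G.Adj v (F (a + c - 1)) := fun h => hvu h h0
  have hn0 : ¬ G.Adj v (F a) := fun h => huv h h1
  obtain ⟨u, hu, hua⟩ := h1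
  obtain ⟨m, hm, hmc, rfl, hm1, hm2⟩ := hF.middle_rep (by omega) a hu
  obtain ⟨u', hu', hua'⟩ := h0
  obtain ⟨m', hm', hmc', rfl, hm1', hm2'⟩ := hF.middle_rep (by omega) a hu'
  have e1 : m ≠ a := by rintro rfl; rw [hwrap] at hm1; exact hn1 hm1
  have e2 : m ≠ a + c - 1 := by rintro rfl; rw [hwrap'] at hm2; exact hn0 hm2
  have e1' : m' ≠ a := by rintro rfl; rw [hwrap] at hm1'; exact hn1 hm1'
  have e2' : m' ≠ a + c - 1 := by rintro rfl; rw [hwrap'] at hm2'; exact hn0 hm2'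
  rcases lt_trichotomy m m' with h | rfl | h
  · refine hF.not_insert hmax hv (a := a)
      (((PathOn.Icc hadj (show a ≤ m - 1 by omega)).symm.append' hua'.symm
        (PathOn.Icc hadj (show m' ≤ a + c - 1 by omega)) ?_).append' hua.symm
        (PathOn.Icc hadj (show m ≤ m' - 1 by omega)) ?_) ?_ hm1 hm1'
    · intro x; simp only [mem_Icc]; omega
    · intro x; simp only [mem_Icc, mem_union]; omega
    · ext x; simp; omega
  · refine hF.not_insert hmax hv (a := a)
      (((PathOn.Icc hadj (show m + 1 ≤ a + c - 1 by omega)).append' hua.symm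
        (PathOn.single m) ?_).append' hua'
        (PathOn.Icc hadj (show a ≤ m - 1 by omega)) ?_) ?_ hm2 hm1
    · intro x; simp only [mem_Icc, mem_singleton]; omega
    · intro x; simp only [mem_Icc, mem_union, mem_singleton]; omega
    · ext x; simp; omega
  · refine hF.not_insert hmax hv (a := a)
      (((PathOn.Icc hadj (show m + 1 ≤ a + c - 1 by omega)).append' hua.symm
        (PathOn.Icc hadj (show m' ≤ m by omega)).symm ?_).append' hua'
        (PathOn.Icc hadj (show a ≤ m' - 1 by omega)) ?_) ?_ hm2 hm1'
    · intro x; simp only [mem_Icc]; omega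
    · intro x; simp only [mem_Icc, mem_union]; omega
    · ext x; simp; omega

theorem IsCyc.not_attached_add_one [Finite V] [DecidableEq V]
    (hF : IsCyc G c F)
    (hmax : ∀ a b S, PathOn G a b S → G.Adj b a → S.card ≤ c) (hv : ∀ i, F i ≠ v) {i : ℤ}
    (h1 : Attached G F v (F i)) : ¬ Attached G F v (F (i + 1)) := by
  refine hF.not_attached_succ hmax hv ?_
  rwa [show i + 1 + c - 1 = i + c by ring, hF.add_period]

theorem IsCyc.not_adj_succ_of_attached [Finite V] [DecidableEq V]
    (hF : IsCyc G c F)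
    (hmax : ∀ a b S, PathOn G a b S → G.Adj b a → S.card ≤ c) (hv : ∀ i, F i ≠ v) {p o : ℤ}
    (hp : G.Adj v (F p)) (ho : Attached G F v (F o)) : ¬ G.Adj (F (p + 1)) (F (o + 1)) := by
  have hc2 := hF.period_pos
  obtain ⟨a, rfl⟩ : ∃ a : ℤ, p = a - 1 := ⟨p + 1, by ring⟩
  obtain ⟨i, hi, hic, hio⟩ := hF.exists_rep (by omega) a o
  have hio' : F (i + 1) = F (o + 1) := by
    rw [hF.2] at hio ⊢
    convert hio using 1; ring
  rw [sub_add_cancel, ← hio']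
  rw [← hio] at ho
  clear hio hio' o
  intro hcross
  have hadj : ∀ i, (G.comap F).Adj i (i + 1) := hF.1
  have hwrap : F (a - 1) = F (a + c - 1) := by
    rw [← hF.add_period (a - 1)]; congr 1; ring
  have hwrap' : F (a + c - 1 + 1) = F a := by
    rw [← hF.add_period a]; congr 1; ring
  rw [hwrap] at hp
  have hsep : ∀ {i}, Attached G F v (F i) → ¬ Attached G F v (F (i + 1)) :=
    fun h => hF.not_attached_add_one hmax hv h
  have hpa : ¬ Attached G F v (F a) := by rw [← hwrap']; exact hsep (Or.inl hp)
  have hi0 : i ≠ a := by rintro rfl; exact hpa ho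
  have hi1 : i ≠ a + c - 1 := by rintro rfl; rw [hwrap'] at hcross; exact hcross.ne rfl
  have hi2 : i ≠ a + c - 2 := by
    rintro rfl
    refine hsep ho (Or.inl ?_)
    rwa [show a + (c : ℤ) - 2 + 1 = a + c - 1 by ring]
  rcases ho with ho | ⟨u, hu, huo⟩
  · refine hF.not_insert hmax hv (a := a) ((PathOn.Icc hadj (show a ≤ i by omega)).symm.append'
      hcross (PathOn.Icc hadj (show i + 1 ≤ a + c - 1 by omega)) ?_) ?_ ho hp
    · intro x; simp only [mem_Icc]; omega
    · ext x; simp; omega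
  obtain ⟨m, hm, hmc, rfl, hm1, hm2⟩ := hF.middle_rep (by omega) a hu
  have e0 : m ≠ a := by
    rintro rfl
    exact hsep (Or.inr ⟨_, hu, huo⟩) (Or.inr ⟨_, hu, hcross⟩)
  have e1 : m ≠ i + 1 := by
    rintro rfl
    exact hpa (Or.inr ⟨_, hu, hcross.symm⟩)
  have e2 : m ≠ a + c - 1 := by
    rintro rfl
    rw [hwrap'] at hm2
    exact hpa (Or.inl hm2)
  have e3 : m ≠ i := by rintro rfl; exact huo.ne rfl
  rcases lt_or_ge m i with h | h
  · refine hF.not_insert hmax hv (a := a)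
      (((PathOn.Icc hadj (show m + 1 ≤ i by omega)).append' huo.symm
        (PathOn.Icc hadj (show a ≤ m by omega)).symm ?_).append' hcross
        (PathOn.Icc hadj (show i + 1 ≤ a + c - 1 by omega)) ?_) ?_ hm2 hp
    · intro x; simp only [mem_Icc]; omega
    · intro x; simp only [mem_Icc, mem_union]; omega
    · ext x; simp; omega
  · refine hF.not_insert hmax hv (a := a)
      (((PathOn.Icc hadj (show m ≤ a + c - 1 by omega)).symm.append' huo
        (PathOn.Icc hadj (show a ≤ i by omega)).symm ?_).append' hcross
        (PathOn.Icc hadj (show i + 1 ≤ m - 1 by omega)) ?_) ?_ hp hm1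
    · intro x; simp only [mem_Icc]; omega
    · intro x; simp only [mem_Icc, mem_union]; omega
    · ext x; simp; omega

theorem IsCyc.not_adj_pred_of_attached [Finite V] [DecidableEq V]
    (hF : IsCyc G c F)
    (hmax : ∀ a b S, PathOn G a b S → G.Adj b a → S.card ≤ c) (hv : ∀ i, F i ≠ v) {p o : ℤ}
    (hp : G.Adj v (F p)) (ho : Attached G F v (F o)) : ¬ G.Adj (F (p - 1)) (F (o - 1)) := by
  have := hF.reverse.not_adj_succ_of_attached hmax (v := v) (fun i => hv _) (p := -p) (o := -o)
    (by simpa using hp) (by simpa using ho.reverse)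
  simp only [neg_add, neg_neg] at this
  exact this

theorem IsCyc.exists_of_attached [Finite V] [DecidableEq V]
    (hF : IsCyc G c F)
    (hmax : ∀ a b S, PathOn G a b S → G.Adj b a → S.card ≤ c) (hv : ∀ i, F i ≠ v)
    (hind : ∀ F', IsCyc G c F' → ∀ x y, (∀ i, F' i ≠ x) → (∀ i, F' i ≠ y) → ¬ G.Adj x y) {x : V}
    (hx : Attached G F v x) : ∃ i, F i = x := by
  by_contra! hxF
  have hc2 := hF.period_pos
  rcases hx with hx | ⟨u, ⟨j, rfl, h1, h2⟩, hx⟩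
  · exact hind F hF _ _ hv hxF hx
  have hadj : ∀ i, (G.comap F).Adj i (i + 1) := hF.1
  have hper : F (j + c - 1) = F (j - 1) := by
    rw [← hF.add_period (j - 1)]; congr 1; ring
  by_cases hxv : x = v
  · subst hxv
    refine hF.not_insert hmax hv (a := j) (PathOn.Icc hadj (show j ≤ j + c - 1 by omega)) ?_
      hx.symm ?_
    · ext; simp
    · rwa [hper]
  -- exchanging `F j` with `v` gives another longest closed walk
  have hinj : Set.InjOn F (Icc (j + 1) (j + c - 1)) := (hF.injOn j).mono (by
    intro i; simp only [coe_Icc, Set.mem_Icc, Set.mem_Ico]; omega)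
  have hvn : v ∉ (Icc (j + 1) (j + c - 1)).image F := by
    rw [mem_image]
    rintro ⟨i, -, hi⟩
    exact hv i hi
  have q := PathOn.cons (G := G) h2 ((PathOn.Icc hadj (show j + 1 ≤ j + c - 1 by omega)).map F
    (fun _ _ h => h) hinj) hvn
  obtain ⟨F', hF', hF'S⟩ := q.exists_isCyc (by rw [hper]; exact h1.symm)
  rw [card_insert_of_notMem hvn, card_image_of_injOn hinj, Int.card_Icc,
    show (j + c - 1 + 1 - (j + 1)).toNat + 1 = c by omega] at hF'
  refine hind F' hF' (F j) x ?_ ?_ hx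
  · intro i hi
    have := hF'S i
    rw [hi, mem_insert, mem_image] at this
    rcases this with h | ⟨l, hl, hlj⟩
    · exact hv _ h
    · rw [mem_Icc] at hl
      have := hF.injOn j (by simp; omega) (by simp; omega) hlj
      omega
  · intro i hi
    have := hF'S i
    rw [hi, mem_insert, mem_image] at this
    rcases this with h | ⟨l, -, hlj⟩
    · exact hxv h
    · exact hxF l hlj

/-- The structure around a vertex `v` missed by a longest closed walk: `T` is the set of vertices
attached to `v`, `Tp` and `Tm` its shifts, `A` and `B` the shifts of the neighbourhood of `v`. -/
theorem IsCyc.exists_shift_structure [Fintype V] [DecidableEq V] [DecidableRel G.Adj]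
    (hF : IsCyc G c F)
    (hmax : ∀ a b S, PathOn G a b S → G.Adj b a → S.card ≤ c) (hv : ∀ i, F i ≠ v)
    (hind : ∀ F', IsCyc G c F' → ∀ x y, (∀ i, F' i ≠ x) → (∀ i, F' i ≠ y) → ¬ G.Adj x y) :
    ∃ T A B Tp Tm : Finset V, (∀ u ∈ insert v (A ∩ B), ∀ x, G.Adj u x → x ∈ T) ∧
      A.card = G.degree v ∧ B.card = G.degree v ∧ A ⊆ Tp ∧ B ⊆ Tm ∧ Tp.card = T.card ∧
      Tm.card = T.card ∧ Disjoint T Tp ∧ Disjoint T Tm ∧ v ∉ T ∧ v ∉ Tp ∧ v ∉ Tm ∧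
      (∀ x ∈ A, ∀ y ∈ Tp, ¬ G.Adj x y) ∧ (∀ x ∈ B, ∀ y ∈ Tm, ¬ G.Adj x y) := by
  classical
  have hT : ∀ x ∈ (univ.filter fun x => Attached G F v x), ∃ i, F i = x := fun x hx =>
    hF.exists_of_attached hmax hv hind (mem_filter.1 hx).2
  have hN : ∀ x ∈ G.neighborFinset v, ∃ i, F i = x := fun x hx =>
    hF.exists_of_attached hmax hv hind (Or.inl (by simpa using hx))
  have hvs : ∀ T s, v ∉ shift F T s := fun T s h => by
    obtain ⟨j, -, hj⟩ := mem_shift.1 h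
    exact hv _ hj
  have hmono : ∀ s, shift F (G.neighborFinset v) s ⊆
      shift F (univ.filter fun x => Attached G F v x) s := by
    intro s u hu
    obtain ⟨j, hj, rfl⟩ := mem_shift.1 hu
    exact mem_shift.2 ⟨j, mem_filter.2 ⟨mem_univ _, Or.inl (by simpa using hj)⟩, rfl⟩
  refine ⟨univ.filter fun x => Attached G F v x, shift F (G.neighborFinset v) 1,
    shift F (G.neighborFinset v) (-1), shift F (univ.filter fun x => Attached G F v x) 1,
    shift F (univ.filter fun x => Attached G F v x) (-1), ?_, ?_, ?_, hmono 1, hmono (-1),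
    hF.card_shift hT _, hF.card_shift hT _, ?_, ?_, ?_, hvs _ _, hvs _ _, ?_, ?_⟩
  · intro u hu x hux
    refine mem_filter.2 ⟨mem_univ _, ?_⟩
    rcases mem_insert.1 hu with rfl | hu
    · exact Or.inl hux
    · obtain ⟨hu1, hu2⟩ := mem_inter.1 hu
      obtain ⟨j, -, rfl⟩ := mem_shift.1 hu1
      rw [hF.apply_mem_shift, mem_neighborFinset] at hu1 hu2
      rw [sub_neg_eq_add] at hu2
      exact Or.inr ⟨_, ⟨_, rfl, hu1, hu2⟩, hux⟩
  · rw [hF.card_shift hN, card_neighborFinset_eq_degree]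
  · rw [hF.card_shift hN, card_neighborFinset_eq_degree]
  · rw [Finset.disjoint_right]
    intro u hu hu'
    obtain ⟨j, hj, rfl⟩ := mem_shift.1 hu
    rw [mem_filter] at hj hu'
    exact hF.not_attached_add_one hmax hv hj.2 hu'.2
  · rw [Finset.disjoint_right]
    intro u hu hu'
    obtain ⟨j, hj, rfl⟩ := mem_shift.1 hu
    rw [mem_filter] at hj hu'
    exact hF.not_attached_add_one hmax hv hu'.2 (by simpa using hj.2)
  · intro h
    obtain ⟨i, hi⟩ := hT _ h
    exact hv i hi
  · intro x hx y hy
    obtain ⟨p, hp, rfl⟩ := mem_shift.1 hx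
    obtain ⟨o, ho, rfl⟩ := mem_shift.1 hy
    exact hF.not_adj_succ_of_attached hmax hv (by simpa using hp) (mem_filter.1 ho).2
  · intro x hx y hy
    obtain ⟨p, hp, rfl⟩ := mem_shift.1 hx
    obtain ⟨o, ho, rfl⟩ := mem_shift.1 hy
    exact hF.not_adj_pred_of_attached hmax hv (by simpa using hp) (mem_filter.1 ho).2

end Middle

section Bipartite

variable {V : Type*}

theorem low_degree_counts {H : SimpleGraph V} [DecidableRel H.Adj] {P Q : Finset V} {m : ℕ}
    (hP : P.card = m) (hQ : Q.card = m) {x y : V} (hx : x ∈ P) (hy : y ∈ Q)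
    (hmax : ∀ x' ∈ P, ∀ y' ∈ Q, ¬ H.Adj x' y' →
      (Q.filter fun u => H.Adj x' u).card + (P.filter fun u => H.Adj y' u).card ≤
        (Q.filter fun u => H.Adj x u).card + (P.filter fun u => H.Adj y u).card)
    (hm : (Q.filter fun u => H.Adj x u).card + (P.filter fun u => H.Adj y u).card ≤ m) :
    (Q.filter fun u => H.Adj x u).card ≤ (P.filter fun x' =>
        (Q.filter fun u => H.Adj x' u).card ≤ (Q.filter fun u => H.Adj x u).card).card ∧
      m - (Q.filter fun u => H.Adj x u).card ≤ (Q.filter fun y' =>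
        (P.filter fun u => H.Adj y' u).card ≤ m - (Q.filter fun u => H.Adj x u).card).card := by
  have h1 := card_filter_add_card_filter_not (s := Q) fun u => H.Adj x u
  have h2 := card_filter_add_card_filter_not (s := P) fun u => H.Adj y u
  constructor
  · refine le_trans (by omega) (card_le_card (s := P.filter fun u => ¬ H.Adj y u) ?_)
    intro x' hx'
    rw [mem_filter] at hx' ⊢
    have := hmax x' hx'.1 y hy fun h => hx'.2 h.symm
    exact ⟨hx'.1, by omega⟩
  · refine le_trans (by omega) (card_le_card (s := Q.filter fun u => ¬ H.Adj x u) ?_)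
    intro y' hy'
    rw [mem_filter] at hy' ⊢
    have := hmax x hx y' hy'.1 hy'.2
    exact ⟨hy'.1, by omega⟩

variable [DecidableEq V]

theorem exists_pathOn_of_complete_bipartite {H : SimpleGraph V} (m : ℕ) :
    ∀ P Q : Finset V, P.card = m + 1 → Q.card = m + 1 → Disjoint P Q →
      (∀ x ∈ P, ∀ y ∈ Q, H.Adj x y) → ∃ a ∈ P, ∃ b ∈ Q, PathOn H a b (P ∪ Q) := by
  induction m with
  | zero =>
    intro P Q hP hQ _ hadj
    obtain ⟨a, rfl⟩ := card_eq_one.1 hP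
    obtain ⟨b, rfl⟩ := card_eq_one.1 hQ
    have h := hadj a (by simp) b (by simp)
    exact ⟨a, by simp, b, by simp, (PathOn.single a).append h (PathOn.single b) (by simp [h.ne])⟩
  | succ m ih =>
    intro P Q hP hQ hd hadj
    obtain ⟨x, hx⟩ : P.Nonempty := card_pos.1 (by omega)
    obtain ⟨y, hy⟩ : Q.Nonempty := card_pos.1 (by omega)
    obtain ⟨a, ha, b, hb, p⟩ := ih (P.erase x) (Q.erase y) (by rw [card_erase_of_mem hx]; omega)
      (by rw [card_erase_of_mem hy]; omega)
      (hd.mono (erase_subset _ _) (erase_subset _ _))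
      fun u hu w hw => hadj u (mem_of_mem_erase hu) w (mem_of_mem_erase hw)
    have hxQ : x ∉ Q := Finset.disjoint_left.1 hd hx
    have hyP : y ∉ P := Finset.disjoint_right.1 hd hy
    refine ⟨x, hx, b, mem_of_mem_erase hb, ?_⟩
    have hay := (hadj a (mem_of_mem_erase ha) y hy).symm
    have hxy := hadj x hx y hy
    have := PathOn.cons hxy (PathOn.cons hay p (by simp [hyP])) (by simp [hxQ, hxy.ne])
    convert this using 1
    ext u
    simp only [mem_union, mem_insert, mem_erase]
    by_cases h1 : u = x <;> by_cases h2 : u = y <;> simp [h1, h2, hx, hy]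

variable [Fintype V]

/-- If adding one edge to a bipartite non-Hamiltonian graph makes it Hamiltonian, then the ends of
that edge have small degree sum. -/
theorem degree_sum_le_of_bipartite_saturated {H : SimpleGraph V} [DecidableRel H.Adj]
    {P Q : Finset V} {m : ℕ} (hPQ : Disjoint P Q) (hU : P ∪ Q = univ) (hP : P.card = m)
    (hQ : Q.card = m) (hm : 2 ≤ m) (hbip : ∀ x y, H.Adj x y → (x ∈ P ↔ y ∈ Q))
    (hno : ∀ a b, PathOn H a b univ → ¬ H.Adj b a) {x y : V} (hx : x ∈ P) (hy : y ∈ Q)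
    {a b : V} (p : PathOn (H ⊔ edge x y) a b univ) (hab : (H ⊔ edge x y).Adj b a) :
    (Q.filter fun u => H.Adj x u).card + (P.filter fun u => H.Adj y u).card ≤ m := by
  classical
  have hPmem : ∀ u, u ∈ P ↔ u ∉ Q := fun u =>
    ⟨fun h => Finset.disjoint_left.1 hPQ h, fun h =>
      (mem_union.1 (hU ▸ mem_univ u : u ∈ P ∪ Q)).resolve_right h⟩
  have hcard : (univ : Finset V).card = 2 * m := by
    rw [← hU, card_union_of_disjoint hPQ]; omega
  obtain ⟨F, hF, -⟩ := p.exists_isCyc hab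
  rw [hcard] at hF
  have himg : ∀ a : ℤ, (Icc a (a + (2 * m : ℕ) - 1)).image F = univ := by
    intro a
    rw [← card_eq_iff_eq_univ, card_image_of_injOn ((hF.injOn a).mono _), ← card_univ, hcard]
    · rw [Int.card_Icc]; omega
    · intro i; simp only [coe_Icc, Set.mem_Icc, Set.mem_Ico]; omega
  obtain ⟨i₀, hi₀⟩ : ∃ i, ¬ H.Adj (F i) (F (i + 1)) := by
    by_contra! hall
    have q := (PathOn.Icc (H := H.comap F) hall (show (0 : ℤ) ≤ 0 + (2 * m : ℕ) - 1 by omega)).map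
      F (fun _ _ h => h) ((hF.injOn 0).mono (by
        intro i; simp only [coe_Icc, Set.mem_Icc, Set.mem_Ico]; omega))
    rw [himg] at q
    refine hno _ _ q ?_
    have := hall (0 + (2 * m : ℕ) - 1)
    rwa [sub_add_cancel, hF.add_period] at this
  have hxy : x ≠ y := by
    rintro rfl
    exact (hPmem x).1 hx hy
  have hstep : ∀ F, IsCyc (H ⊔ edge x y) (2 * m) F → ∀ i, ¬ H.Adj (F i) (F (i + 1)) →
      (F i = x ∧ F (i + 1) = y) ∨ (F i = y ∧ F (i + 1) = x) := by
    intro F hF i hi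
    have := hF.1 i
    rw [sup_adj, edge_adj] at this
    tauto
  -- put the new edge between positions `-1` and `0`
  obtain ⟨E, hE, hEy, hEx⟩ : ∃ E, IsCyc (H ⊔ edge x y) (2 * m) E ∧ E (-1) = y ∧ E 0 = x := by
    rcases hstep F hF i₀ hi₀ with ⟨h1, h2⟩ | ⟨h1, h2⟩
    · refine ⟨_, (hF.rotate i₀).reverse, ?_, ?_⟩
      · simpa [add_comm] using h2
      · simpa using h1
    · refine ⟨_, hF.rotate (i₀ + 1), ?_, ?_⟩
      · simpa using h1
      · simpa using h2
  have hlast : E ((2 * m : ℕ) - 1) = y := by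
    rw [← hEy, ← hE.add_period (-1), neg_add_eq_sub]
  have hEadj : ∀ j : ℤ, 0 ≤ j → j < (2 * m : ℕ) - 1 → H.Adj (E j) (E (j + 1)) := by
    intro j hj0 hj
    by_contra h
    have hinj := hE.injOn 0
    rcases hstep E hE j h with ⟨h1, h2⟩ | ⟨h1, h2⟩
    · have e1 := hinj (by simp; omega) (by simp; omega) (h1.trans hEx.symm)
      have e2 := hinj (by simp; omega) (by simp; omega) (h2.trans hlast.symm)
      omega
    · have e1 := hinj (by simp; omega) (by simp; omega) (h1.trans hlast.symm)
      omega
  have hsub : shift E (Q.filter fun u => H.Adj x u) (-1) ⊆ P.filter fun u => ¬ H.Adj y u := by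
    intro z hz
    obtain ⟨j', hj', rfl⟩ := mem_shift.1 hz
    obtain ⟨j, hj0, hj, hjj⟩ := hE.exists_rep (by omega) 0 j'
    have hjz : E (j' + -1) = E (j - 1) := by
      rw [hE.2] at hjj ⊢
      rwa [← dvd_neg, show -(j' + -1 - (j - 1)) = j - j' by ring]
    rw [← hjj, mem_filter] at hj'
    rw [hjz, mem_filter]
    have hj00 : j ≠ 0 := by
      rintro rfl
      rw [hEx] at hj'
      exact hj'.2.ne rfl
    have hprev := hEadj (j - 1) (by omega) (by omega)
    rw [sub_add_cancel] at hprev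
    refine ⟨(hbip _ _ hprev).2 hj'.1, fun hyz => ?_⟩
    have q := (PathOn.Icc_of_lt (H := H.comap E) (show 0 ≤ j - 1 by omega) fun i h1 h2 =>
        hEadj i h1 (by omega)).append'
      (show H.Adj (E (j - 1)) (E ((2 * m : ℕ) - 1)) by rw [hlast]; exact hyz.symm)
      (PathOn.Icc_of_lt (H := H.comap E) (show j ≤ (2 * m : ℕ) - 1 by omega) fun i h1 h2 =>
        hEadj i (by omega) h2).symm (by intro i; simp only [mem_Icc]; omega)
    rw [show Icc 0 (j - 1) ∪ Icc j ((2 * m : ℕ) - 1) = Ico (0 : ℤ) (2 * m : ℕ) by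
      ext i; simp only [mem_union, mem_Icc, mem_Ico]; omega] at q
    have q' := q.map E (fun _ _ h => h) (by
      have := hE.injOn 0
      rw [zero_add] at this
      rwa [coe_Ico])
    rw [(card_eq_iff_eq_univ _).1 (hE.card_image.trans (by rw [← card_univ, hcard]))] at q'
    exact hno _ _ q' (by rw [hEx]; exact hj'.2.symm)
  have h1 := card_le_card hsub
  have h2 := card_filter_add_card_filter_not (s := P) fun u => H.Adj y u
  rw [hE.card_shift (fun u _ => by
    have : u ∈ (Ico (0 : ℤ) (2 * m : ℕ)).image E := by
      rw [(card_eq_iff_eq_univ _).1 (hE.card_image.trans (by rw [← card_univ, hcard]))]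
      exact mem_univ u
    obtain ⟨i, -, hi⟩ := mem_image.1 this
    exact ⟨i, hi⟩)] at h1
  omega

/-- A bipartite degree sequence condition for Hamiltonicity, applied to the edges of `G` between
two halves `P` and `Q`. -/
theorem exists_low_degrees {G : SimpleGraph V} [DecidableRel G.Adj] {P Q : Finset V} {m : ℕ}
    (hPQ : Disjoint P Q) (hU : P ∪ Q = univ) (hP : P.card = m) (hQ : Q.card = m) (hm : 2 ≤ m)
    (hno : ∀ a b, PathOn G a b univ → ¬ G.Adj b a) :
    ∃ j, 2 * j ≤ m ∧ ((∃ x ∈ P, (Q.filter fun u => G.Adj x u).card ≤ j) ∨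
        ∃ y ∈ Q, (P.filter fun u => G.Adj y u).card ≤ j) ∧
      ((j ≤ (P.filter fun x => (Q.filter fun u => G.Adj x u).card ≤ j).card ∧
          m - j ≤ (Q.filter fun y => (P.filter fun u => G.Adj y u).card ≤ m - j).card) ∨
        (j ≤ (Q.filter fun y => (P.filter fun u => G.Adj y u).card ≤ j).card ∧
          m - j ≤ (P.filter fun x => (Q.filter fun u => G.Adj x u).card ≤ m - j).card)) := by
  classical
  have hPmem : ∀ u, u ∈ P ↔ u ∉ Q := fun u =>
    ⟨fun h => Finset.disjoint_left.1 hPQ h, fun h =>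
      (mem_union.1 (hU ▸ mem_univ u : u ∈ P ∪ Q)).resolve_right h⟩
  let B : SimpleGraph V :=
    { Adj := fun x y => G.Adj x y ∧ (x ∈ P ↔ y ∈ Q)
      symm := ⟨fun x y h => ⟨h.1.symm, by have := h.2; rw [hPmem] at this ⊢; tauto⟩⟩
      loopless := ⟨fun x h => h.1.ne rfl⟩ }
  have hBmem : (∀ x y, B.Adj x y → (x ∈ P ↔ y ∈ Q)) ∧ ∀ a b, PathOn B a b univ → ¬ B.Adj b a :=
    ⟨fun x y h => h.2, fun a b p h => hno a b (by
      simpa using p.map (H := G) id (fun x y (h : B.Adj x y) => h.1) (Set.injOn_id _)) h.1⟩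
  obtain ⟨H, hBH, ⟨hbip, hHno⟩, hHmax⟩ := (Set.toFinite {H : SimpleGraph V |
    (∀ x y, H.Adj x y → (x ∈ P ↔ y ∈ Q)) ∧
      ∀ a b, PathOn H a b univ → ¬ H.Adj b a}).exists_le_maximal hBmem
  have hne : ((P ×ˢ Q).filter fun z => ¬ H.Adj z.1 z.2).Nonempty := by
    by_contra hemp
    rw [not_nonempty_iff_eq_empty, filter_eq_empty_iff] at hemp
    have hall : ∀ x ∈ P, ∀ y ∈ Q, H.Adj x y := fun x hx y hy =>
      not_not.1 (hemp (mem_product.2 ⟨hx, hy⟩ : (x, y) ∈ P ×ˢ Q))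
    obtain ⟨a, ha, b, hb, p⟩ := exists_pathOn_of_complete_bipartite (m - 1) P Q (by omega)
      (by omega) hPQ hall
    exact hHno a b (hU ▸ p) (hall a ha b hb).symm
  obtain ⟨⟨x, y⟩, hz, hmax⟩ := exists_max_image _ (fun z : V × V =>
    (Q.filter fun u => H.Adj z.1 u).card + (P.filter fun u => H.Adj z.2 u).card) hne
  simp only [mem_filter, mem_product] at hz hmax
  obtain ⟨⟨hx, hy⟩, hxy⟩ := hz
  have hxyne : x ≠ y := by
    rintro rfl
    exact (hPmem x).1 hx hy
  obtain ⟨a, b, p, hab⟩ : ∃ a b, PathOn (H ⊔ edge x y) a b univ ∧ (H ⊔ edge x y).Adj b a := by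
    by_contra! h
    have := hHmax (y := H ⊔ edge x y) ⟨fun u w huw => ?_, fun a b p => h a b p⟩ le_sup_left
    · exact hxy (this (by rw [sup_adj, edge_adj]; exact Or.inr ⟨Or.inl ⟨rfl, rfl⟩, hxyne⟩))
    · rw [sup_adj, edge_adj] at huw
      rcases huw with huw | ⟨⟨rfl, rfl⟩ | ⟨rfl, rfl⟩, -⟩
      · exact hbip u w huw
      · simp [hx, hy]
      · rw [hPmem]; simp [hy, (hPmem _).1 hx]
  have hsum := degree_sum_le_of_bipartite_saturated hPQ hU hP hQ hm hbip hHno hx hy p hab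
  have hdegP : ∀ u ∈ P, (Q.filter fun w => G.Adj u w).card ≤ (Q.filter fun w => H.Adj u w).card :=
    fun u hu => card_le_card fun w hw => by
      rw [mem_filter] at hw ⊢
      exact ⟨hw.1, hBH ⟨hw.2, by simp [hu, hw.1]⟩⟩
  have hdegQ : ∀ u ∈ Q, (P.filter fun w => G.Adj u w).card ≤ (P.filter fun w => H.Adj u w).card :=
    fun u hu => card_le_card fun w hw => by
      rw [mem_filter] at hw ⊢
      exact ⟨hw.1, hBH ⟨hw.2, by rw [hPmem]; simp [hu, (hPmem w).1 hw.1]⟩⟩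
  have hmonoP : ∀ l, (P.filter fun x => (Q.filter fun u => H.Adj x u).card ≤ l).card ≤
      (P.filter fun x => (Q.filter fun u => G.Adj x u).card ≤ l).card := fun l =>
    card_le_card fun w hw => by
      rw [mem_filter] at hw ⊢
      exact ⟨hw.1, (hdegP w hw.1).trans hw.2⟩
  have hmonoQ : ∀ l, (Q.filter fun x => (P.filter fun u => H.Adj x u).card ≤ l).card ≤
      (Q.filter fun x => (P.filter fun u => G.Adj x u).card ≤ l).card := fun l =>
    card_le_card fun w hw => by
      rw [mem_filter] at hw ⊢
      exact ⟨hw.1, (hdegQ w hw.1).trans hw.2⟩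
  rcases le_total (Q.filter fun u => H.Adj x u).card (P.filter fun u => H.Adj y u).card with h | h
  · obtain ⟨h1, h2⟩ := low_degree_counts hP hQ hx hy
      (fun x' hx' y' hy' h => hmax ⟨x', y'⟩ ⟨⟨hx', hy'⟩, h⟩) hsum
    exact ⟨_, by omega, Or.inl ⟨x, hx, hdegP x hx⟩,
      Or.inl ⟨h1.trans (hmonoP _), h2.trans (hmonoQ _)⟩⟩
  · obtain ⟨h1, h2⟩ := low_degree_counts (H := H) hQ hP hy hx
      (fun x' hx' y' hy' h => by
        have := hmax (y', x') ⟨⟨hy', hx'⟩, fun h' => h h'.symm⟩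
        dsimp only at this
        omega) (by omega)
    exact ⟨_, by omega, Or.inr ⟨y, hy, hdegQ y hy⟩,
      Or.inr ⟨h1.trans (hmonoQ _), h2.trans (hmonoP _)⟩⟩

end Bipartite

section Arithmetic

theorem add_three_le_of_degBound_le {k n N d : ℕ} (hk : 0 < k) (hn : n = k * N)
    (h : degBound n k ≤ d) :
    (n : ℤ) + 3 ≤ 2 * (k / 2 + 1 : ℕ) * (N + d - (n + 1) / 2 + 1) := by
  have hceil : ∀ a : ℕ, ⌈(a : ℚ) / 2⌉ = ((a : ℤ) + 1) / 2 := fun a => by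
    rw [Int.ceil_eq_iff]
    obtain ⟨b, rfl | rfl⟩ := Nat.even_or_odd' a
    · rw [show (((2 * b : ℕ) : ℤ) + 1) / 2 = b by omega]
      push_cast
      constructor <;> linarith
    · rw [show (((2 * b + 1 : ℕ) : ℤ) + 1) / 2 = b + 1 by omega]
      push_cast
      constructor <;> linarith
  have hk1 := hceil (k + 1)
  push_cast at hk1
  unfold degBound at h
  rw [hk1, hceil, show ((k : ℤ) + 1 + 1) / 2 = (k / 2 + 1 : ℕ) by omega,
    show (n : ℚ) / k = N by
      rw [hn]; push_cast; rw [mul_div_cancel_left₀]; positivity] at h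
  set t := k / 2 + 1
  set f := ⌊((n : ℚ) + 2) / (2 * ((t : ℤ) : ℚ))⌋ with hf
  have ht : (0 : ℚ) < 2 * ((t : ℤ) : ℚ) := by
    have : 0 < t := by omega
    positivity
  have h1 : ((n : ℚ) + 2) / (2 * ((t : ℤ) : ℚ)) < f + 1 := Int.lt_floor_add_one _
  rw [div_lt_iff₀ ht] at h1
  have h2 : (n : ℤ) + 2 < (f + 1) * (2 * t) := by exact_mod_cast h1
  have h3 : ((n : ℤ) + 1) / 2 + f - N ≤ d := by exact_mod_cast h
  have : (f + 1) * (2 * t) ≤ (N + d - ((n : ℤ) + 1) / 2 + 1) * (2 * t) := by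
    gcongr
    linarith
  linarith

end Arithmetic

section Parts

variable {V : Type*} [Fintype V] {G : SimpleGraph V} [DecidableRel G.Adj]
  {k N d : ℕ} {P : V → Fin k}

theorem card_filter_mem_parts (hpart : ∀ i, (univ.filter fun v => P v = i).card = N)
    (S : Finset (Fin k)) : (univ.filter fun v => P v ∈ S).card = S.card * N := by
  rw [card_eq_sum_card_fiberwise (f := P) (t := S) (by intro x; simp)]
  rw [sum_congr rfl (g := fun _ => N), sum_const, smul_eq_mul]
  intro i hi
  rw [← hpart i, filter_filter]
  congr 1
  ext v
  simp only [mem_filter]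
  grind

theorem card_filter_notMem_parts {h m : ℕ}
    (hpart : ∀ i, (univ.filter fun v => P v = i).card = N) (hk : k = 2 * h) (hm : m = h * N)
    {M : Finset (Fin k)} (hM : M.card = h) :
    (univ.filter fun v => P v ∈ M).card = m ∧ (univ.filter fun v => P v ∉ M).card = m := by
  refine ⟨by rw [card_filter_mem_parts hpart, hM, hm], ?_⟩
  have := card_filter_mem_parts hpart Mᶜ
  rw [card_compl, Fintype.card_fin, hM, show k - h = h by omega, ← hm] at this
  simpa using this

theorem card_filter_parts_le {T I : Finset V} (hadj : ∀ u v, G.Adj u v → P u ≠ P v)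
    (hd : ∀ v, d ≤ G.degree v) (hI : ∀ u ∈ I, ∀ x, G.Adj u x → x ∈ T) {S : Finset (Fin k)}
    (hS : S ⊆ I.image P) :
    (T.filter fun x => P x ∈ S).card + S.card * d ≤ S.card * T.card := by
  rw [card_eq_sum_card_fiberwise (f := P) (s := T.filter fun x => P x ∈ S) (t := S)
    (by intro x; simp), ← smul_eq_mul, ← sum_const, ← sum_add_distrib, ← smul_eq_mul, ← sum_const]
  refine sum_le_sum fun i hi => ?_
  obtain ⟨u, hu, rfl⟩ := mem_image.1 (hS hi)
  have h1 := card_filter_add_card_filter_not (s := T) fun x => P x = P u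
  have h2 : G.neighborFinset u ⊆ T.filter fun x => ¬ P x = P u := fun x hx => by
    rw [mem_neighborFinset] at hx
    exact mem_filter.2 ⟨hI u hu x hx, (hadj u x hx).symm⟩
  have h3 := (hd u).trans (card_le_card h2)
  have h4 := card_le_card (s := (T.filter fun x => P x ∈ S).filter fun x => P x = P u)
    (t := T.filter fun x => P x = P u) (filter_subset_filter _ (filter_subset _ _))
  omega

variable [DecidableEq V]

theorem two_mul_add_le_of_separated {D E : Finset V} {y u z : V}
    (hpart : ∀ i, (univ.filter fun v => P v = i).card = N) (hadj : ∀ u v, G.Adj u v → P u ≠ P v)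
    (hd : ∀ v, d ≤ G.degree v) (hDE : Disjoint D E) (hzD : z ∉ D) (hzE : z ∉ E)
    (hU : ∀ x, x ∈ D ∨ x ∈ E ∨ x = z) (hno : ∀ a ∈ D, ∀ b ∈ E, ¬ G.Adj a b)
    (hy : y ∈ D) (hu : u ∈ E) (hyz : P y = P z) : 2 * d + N ≤ Fintype.card V := by
  have hside : ∀ w, P w = P z → w ≠ z → ∀ x, G.Adj w x → P x ≠ P z ∧ x ≠ z := fun w hw hwz x hx =>
    ⟨fun h => hadj w x hx (hw.trans h.symm), fun h => hadj w x hx (h ▸ hw)⟩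
  have h1 : G.neighborFinset y ⊆ D.filter fun x => P x ≠ P z := fun x hx => by
    rw [mem_neighborFinset] at hx
    have := hside y hyz (by rintro rfl; exact hzD hy) x hx
    rw [mem_filter]
    refine ⟨?_, this.1⟩
    rcases hU x with h | h | h
    · exact h
    · exact absurd hx (hno y hy x h)
    · exact absurd h this.2
  have c1 := (hd y).trans (card_le_card h1)
  have c3 := hpart (P z)
  by_cases hw : ∃ w ∈ E, P w = P z
  · obtain ⟨w, hwE, hwz⟩ := hw
    have h2 : G.neighborFinset w ⊆ E.filter fun x => P x ≠ P z := fun x hx => by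
      rw [mem_neighborFinset] at hx
      have := hside w hwz (by rintro rfl; exact hzE hwE) x hx
      rw [mem_filter]
      refine ⟨?_, this.1⟩
      rcases hU x with h | h | h
      · exact absurd hx.symm (hno x h w hwE)
      · exact h
      · exact absurd h this.2
    have c2 := (hd w).trans (card_le_card h2)
    have hdis : Disjoint (D.filter fun x => P x ≠ P z) (E.filter fun x => P x ≠ P z) :=
      disjoint_filter_filter hDE
    have c4 := card_le_card (s := (D.filter fun x => P x ≠ P z) ∪ (E.filter fun x => P x ≠ P z))
      (t := univ.filter fun x => ¬ P x = P z) fun x => by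
        simp only [mem_union, mem_filter, mem_univ, true_and]; tauto
    rw [card_union_of_disjoint hdis] at c4
    have c5 := card_filter_add_card_filter_not (s := univ) fun x => P x = P z
    rw [card_univ] at c5
    omega
  · push Not at hw
    have h2 : G.neighborFinset u ⊆ insert z (E.erase u) := fun x hx => by
      rw [mem_neighborFinset] at hx
      rw [mem_insert, mem_erase]
      rcases hU x with h | h | h
      · exact absurd hx.symm (hno x h u hu)
      · exact Or.inr ⟨hx.ne', h⟩
      · exact Or.inl h
    have c2 := ((hd u).trans (card_le_card h2)).trans (card_insert_le _ _)
    rw [card_erase_of_mem hu] at c2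
    have hE : 0 < E.card := card_pos.2 ⟨u, hu⟩
    have hdis : Disjoint (D.filter fun x => P x ≠ P z) E := hDE.mono_left (filter_subset _ _)
    have c4 := card_le_card (s := (D.filter fun x => P x ≠ P z) ∪ E)
      (t := univ.filter fun x => ¬ P x = P z) fun x => by
        simp only [mem_union, mem_filter, mem_univ, true_and]
        rintro (h | h)
        · exact h.2
        · exact hw x h
    rw [card_union_of_disjoint hdis] at c4
    have c5 := card_filter_add_card_filter_not (s := univ) fun x => P x = P z
    rw [card_univ] at c5
    omega

/-- Under either degree condition, removing one vertex leaves the graph connected. -/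
theorem exists_adj_of_cut (hpart : ∀ i, (univ.filter fun v => P v = i).card = N)
    (hadj : ∀ u v, G.Adj u v → P u ≠ P v) (hd : ∀ v, d ≤ G.degree v)
    (hlarge : Fintype.card V ≤ 2 * d ∨ 2 ≤ N ∧ Fintype.card V < 2 * d + N)
    (D : Finset V) (z : V) (hz : z ∉ D) (hD : D.Nonempty) (hE : ∃ x, x ∉ D ∧ x ≠ z) :
    ∃ a ∈ D, ∃ b, b ∉ D ∧ b ≠ z ∧ G.Adj a b := by
  by_contra! hcut
  obtain ⟨u, huD, huz⟩ := hE
  obtain ⟨y, hy⟩ := hD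
  set E := univ.filter fun x => x ∉ D ∧ x ≠ z with hEdef
  have hmemE : ∀ x, x ∈ E ↔ x ∉ D ∧ x ≠ z := by simp [hEdef]
  have hDE : Disjoint D E := Finset.disjoint_left.2 fun x hx h => ((hmemE x).1 h).1 hx
  have hzE : z ∉ E := by simp [hEdef]
  have hU : ∀ x, x ∈ D ∨ x ∈ E ∨ x = z := fun x => by rw [hmemE]; tauto
  have hno : ∀ a ∈ D, ∀ b ∈ E, ¬ G.Adj a b := fun a ha b hb =>
    hcut a ha b ((hmemE b).1 hb).1 ((hmemE b).1 hb).2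
  have hu : u ∈ E := (hmemE u).2 ⟨huD, huz⟩
  rcases hlarge with hlarge | ⟨hN, hlarge⟩
  · have hside : ∀ S S' : Finset V, (∀ x, x ∈ S ∨ x ∈ S' ∨ x = z) →
        (∀ a ∈ S, ∀ b ∈ S', ¬ G.Adj a b) → ∀ w ∈ S, d ≤ S.card := fun S S' hS hnoS w hw => by
      have h : G.neighborFinset w ⊆ insert z (S.erase w) := fun x hx => by
        rw [mem_neighborFinset] at hx
        rw [mem_insert, mem_erase]
        rcases hS x with h | h | h
        · exact Or.inr ⟨hx.ne', h⟩
        · exact absurd hx (hnoS w hw x h)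
        · exact Or.inl h
      have c := ((hd w).trans (card_le_card h)).trans (card_insert_le _ _)
      rw [card_erase_of_mem hw] at c
      have := card_pos.2 ⟨w, hw⟩
      omega
    have c1 := hside D E hU hno y hy
    have c2 := hside E D (fun x => by rcases hU x with h | h | h <;> tauto)
      (fun a ha b hb h => hno b hb a ha h.symm) u hu
    have c3 := card_lt_univ_of_notMem (s := D ∪ E) (x := z) (by simp [hz, hzE])
    rw [card_union_of_disjoint hDE] at c3
    omega
  · obtain ⟨w, hw, hwz⟩ := exists_mem_ne (s := univ.filter fun v => P v = P z)
      (by rw [hpart]; omega) z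
    rw [mem_filter] at hw
    rcases hU w with h | h | h
    · have := two_mul_add_le_of_separated hpart hadj hd hDE hz hzE hU hno h hu hw.2
      omega
    · have := two_mul_add_le_of_separated hpart hadj hd hDE.symm hzE hz
        (fun x => by rcases hU x with h | h | h <;> tauto)
        (fun a ha b hb h => hno b hb a ha h.symm) h hy hw.2
      omega
    · exact hwz h

theorem card_image_parts_lt {T I : Finset V} {t C : ℕ}
    (hpart : ∀ i, (univ.filter fun v => P v = i).card = N) (hadj : ∀ u v, G.Adj u v → P u ≠ P v)
    (hd : ∀ v, d ≤ G.degree v) (hI : ∀ u ∈ I, ∀ x, G.Adj u x → x ∈ T)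
    (hC : Fintype.card V ≤ 2 * C) (hT : T.card + 1 ≤ C)
    (hbound : Fintype.card V + 3 ≤ 2 * (t : ℤ) * (N + d - C + 1)) : (I.image P).card < t := by
  by_contra! hlt
  obtain ⟨S, hS, hSt⟩ := exists_subset_card_eq hlt
  have h1 := card_filter_parts_le hadj hd hI hS
  have h2 := card_filter_mem_parts hpart S
  have h3 : (univ.filter fun v => P v ∈ S).card ≤
      (T.filter fun x => P x ∈ S).card + Tᶜ.card := by
    refine le_trans (card_le_card fun x hx => ?_) (card_union_le _ _)
    simp only [mem_union, mem_filter, mem_compl, mem_univ, true_and] at hx ⊢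
    tauto
  have h4 := card_add_card_compl T
  rw [hSt] at h1 h2
  have h5 : (t : ℤ) * N + t * d + T.card ≤ t * T.card + Fintype.card V := by
    exact_mod_cast (by omega : t * N + t * d + T.card ≤ t * T.card + Fintype.card V)
  have ht : 0 < t := by
    rcases Nat.eq_zero_or_pos t with rfl | h
    · simp at hbound; omega
    · exact h
  have h6 : (0 : ℤ) ≤ (t - 1) * (C - 1 - T.card) := by
    apply mul_nonneg <;> omega
  have h7 : (Fintype.card V : ℤ) ≤ 2 * C := by exact_mod_cast hC
  nlinarith

theorem neighborFinset_subset_compl_of_notMem {T I : Finset V}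
    (hpart : ∀ i, (univ.filter fun v => P v = i).card = N) (hadj : ∀ u v, G.Adj u v → P u ≠ P v)
    (hI : ∀ u ∈ I, ∀ x, G.Adj u x → x ∈ T) {x : V} (hx : x ∉ T) (hxI : P x ∉ I.image P) :
    G.neighborFinset x ⊆ (I ∪ univ.filter fun w => P w = P x)ᶜ ∧
      (I ∪ univ.filter fun w => P w = P x).card = I.card + N := by
  constructor
  · intro w hw
    rw [mem_neighborFinset] at hw
    simp only [mem_compl, mem_union, mem_filter, mem_univ, true_and, not_or]
    exact ⟨fun h => hx (hI w h x hw.symm), (hadj x w hw).symm⟩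
  · rw [card_union_of_disjoint, hpart]
    rw [Finset.disjoint_left]
    intro w hw h
    exact hxI (mem_image.2 ⟨w, hw, (mem_filter.1 h).2⟩)

end Parts

/-- The extremal configuration with two halves, where the missed vertex has `|T| = m - 1`. -/
theorem false_of_extremal {V : Type*} [DecidableEq V] {G : SimpleGraph V} {k : ℕ} {P : V → Fin k}
    {A B T Tp Tm : Finset V} {v : V} {r m : ℕ} {Q : Finset V} (hr : 2 ≤ r)
    (hdis : ∀ x ∈ A \ B, x ∉ T) (hdis' : ∀ x ∈ B \ A, x ∉ T) (hcardU : (A ∪ B).card = m)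
    (hBA : (B \ A).card = r) (hAB : (A \ B).card = r)
    (hATp : A ⊆ Tp) (hBTm : B ⊆ Tm) (hTp : Tp ⊆ A ∪ B) (hTpcard : m ≤ Tp.card + 1)
    (hAadj : ∀ x ∈ A, ∀ y ∈ Tp, ¬ G.Adj x y) (hBadj : ∀ x ∈ B, ∀ y ∈ Tm, ¬ G.Adj x y)
    (hfull : ∀ x ∈ Q, x ∉ T → ∀ w, w ∉ insert v (A ∩ B) → P w ≠ P x → G.Adj x w)
    (hQP : ∀ x w, x ∈ Q → P w = P x → w ∈ Q) (hQT : (Q \ T).card < 2 * r)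
    (hvA : v ∉ A) (hvB : v ∉ B) {x : V} (hxQ : x ∈ Q) (hxA : x ∈ A) (hxT : x ∉ T) : False := by
  have hAx : ∀ a ∈ A \ B, P a = P x := fun a ha => by
    rw [mem_sdiff] at ha
    by_contra hne
    refine hAadj x hxA a (hATp ha.1) (hfull x hxQ hxT a ?_ hne)
    rw [mem_insert, mem_inter]
    rintro (rfl | h)
    · exact hvA ha.1
    · exact ha.2 h.2
  obtain ⟨y, hy, hyTp⟩ : ∃ y ∈ B \ A, y ∈ Tp := by
    by_contra! h
    have h1 := card_le_card (s := (B \ A) ∪ Tp) (t := A ∪ B) (union_subset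
      (sdiff_subset.trans subset_union_right) hTp)
    rw [card_union_of_disjoint (Finset.disjoint_left.2 h)] at h1
    omega
  have hyB := mem_sdiff.1 hy
  have hyv : y ∉ insert v (A ∩ B) := by
    rw [mem_insert, mem_inter]
    rintro (rfl | h)
    · exact hvB hyB.1
    · exact hyB.2 h.1
  have hyx : P y = P x := by
    by_contra hne
    exact hAadj x hxA y hyTp (hfull x hxQ hxT y hyv hne)
  have hyQ := hQP x y hxQ hyx
  have hBx : ∀ b ∈ B \ A, P b = P x := fun b hb => by
    have hb' := mem_sdiff.1 hb
    rw [← hyx]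
    by_contra hne
    refine hBadj y hyB.1 b (hBTm hb'.1) (hfull y hyQ (hdis' y hy) b ?_ hne)
    rw [mem_insert, mem_inter]
    rintro (rfl | h)
    · exact hvB hb'.1
    · exact hb'.2 h.1
  have h1 := card_le_card (s := A \ B ∪ B \ A) (t := Q \ T) fun w hw => by
    rw [mem_sdiff]
    rcases mem_union.1 hw with hw | hw
    · exact ⟨hQP x w hxQ (hAx w hw), hdis w hw⟩
    · exact ⟨hQP x w hxQ (hBx w hw), hdis' w hw⟩
  rw [card_union_of_disjoint (Finset.disjoint_left.2 fun w h h' => by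
    rw [mem_sdiff] at h h'; exact h.2 h'.1)] at h1
  omega

section Counting

variable {V : Type*} [Fintype V] [DecidableEq V] {G : SimpleGraph V} [DecidableRel G.Adj]
  {k N d : ℕ} {P : V → Fin k} {T I A B : Finset V} {v : V}

theorem false_of_odd {t C : ℕ} (hk : k + 1 = 2 * t) (hcard : Fintype.card V = k * N)
    (hpart : ∀ i, (univ.filter fun v => P v = i).card = N) (hadj : ∀ u v, G.Adj u v → P u ≠ P v)
    (hd : ∀ v, d ≤ G.degree v) (hI : ∀ u ∈ I, ∀ x, G.Adj u x → x ∈ T)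
    (hC : Fintype.card V ≤ 2 * C) (hT : T.card + 1 ≤ C) (hT' : 2 * T.card < Fintype.card V)
    (hIcard : 3 * d + 2 ≤ I.card + Fintype.card V)
    (hbound : Fintype.card V + 3 ≤ 2 * (t : ℤ) * (N + d - C + 1))
    (hN : 2 * Fintype.card V < 4 * d + 2 + N) : False := by
  have hs := card_image_parts_lt hpart hadj hd hI hC hT hbound
  obtain ⟨x, hxT, hxI⟩ : ∃ x, x ∉ T ∧ P x ∉ I.image P := by
    by_contra! h
    have h1 := card_le_card (s := univ.filter fun x => P x ∈ (I.image P)ᶜ) (t := T) fun x hx => by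
      rw [mem_filter, mem_compl] at hx
      by_contra hxT
      exact hx.2 (h x hxT)
    rw [card_filter_mem_parts hpart, card_compl, Fintype.card_fin] at h1
    have h2 : t * N ≤ (k - (I.image P).card) * N := Nat.mul_le_mul_right _ (by omega)
    have h3 : (k + 1) * N = 2 * t * N := by rw [hk]
    rw [mul_assoc, add_mul] at h3
    omega
  obtain ⟨h1, h2⟩ := neighborFinset_subset_compl_of_notMem hpart hadj hI hxT hxI
  have h3 := (hd x).trans (card_le_card h1)
  rw [card_compl, h2] at h3
  have h4 := card_le_univ (I ∪ univ.filter fun w => P w = P x)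
  omega

theorem card_insert_inter_add_card_union (hvA : v ∉ A) (hA : A.card = G.degree v)
    (hB : B.card = G.degree v) (hAT : Disjoint T A) (hBT : Disjoint T B) (hvB : v ∉ B)
    (hvT : v ∉ T) :
    (insert v (A ∩ B)).card + (A ∪ B).card = 2 * G.degree v + 1 ∧
      (A ∪ B).card + T.card + 1 ≤ Fintype.card V ∧
      ((A ∪ B).card + T.card + 1 = Fintype.card V → ∀ x, x ∉ T → x = v ∨ x ∈ A ∪ B) := by
  have h1 := card_union_add_card_inter A B
  rw [card_insert_of_notMem (by simp [hvA])]
  have h2 : (insert v (A ∪ B ∪ T)).card = (A ∪ B).card + T.card + 1 := by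
    rw [card_insert_of_notMem (by simp [hvA, hvB, hvT]), card_union_of_disjoint]
    rw [disjoint_union_left]
    exact ⟨hAT.symm, hBT.symm⟩
  refine ⟨by omega, h2 ▸ card_le_univ _, fun h x hx => ?_⟩
  rw [← h2, card_eq_iff_eq_univ] at h
  have := h ▸ mem_univ x
  rw [mem_insert, mem_union] at this
  tauto

end Counting

section Even

variable {V : Type*} [Fintype V] [DecidableEq V] {G : SimpleGraph V} [DecidableRel G.Adj]
  {k N d h m r : ℕ} {P : V → Fin k} {T I A B Tp Tm : Finset V} {v : V}

theorem false_of_even_of_card_add_one_eq (hk : k = 2 * h) (hh : 2 ≤ h) (hm : m = h * N)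
    (hcard : Fintype.card V = 2 * m) (hmd : m = d + r) (hN : (h + 1) * (r - 1) + 2 ≤ N)
    (hN' : 2 * r + 1 ≤ N)
    (hpart : ∀ i, (univ.filter fun v => P v = i).card = N) (hadj : ∀ u v, G.Adj u v → P u ≠ P v)
    (hd : ∀ v, d ≤ G.degree v) (hI : ∀ u ∈ insert v (A ∩ B), ∀ x, G.Adj u x → x ∈ T)
    (hM : ((insert v (A ∩ B)).image P).card = h) (hT : T.card + 1 = m)
    (hA : A.card = G.degree v) (hB : B.card = G.degree v) (hATp : A ⊆ Tp) (hBTm : B ⊆ Tm)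
    (hTp : Tp.card = T.card) (hTm : Tm.card = T.card) (hTTp : Disjoint T Tp)
    (hTTm : Disjoint T Tm) (hvT : v ∉ T) (hvTp : v ∉ Tp) (hvTm : v ∉ Tm)
    (hAadj : ∀ x ∈ A, ∀ y ∈ Tp, ¬ G.Adj x y) (hBadj : ∀ x ∈ B, ∀ y ∈ Tm, ¬ G.Adj x y) :
    False := by
  obtain ⟨hPc, hQc⟩ := card_filter_notMem_parts hpart hk hm hM
  set M := (insert v (A ∩ B)).image P with hMdef
  have hvA : v ∉ A := fun h => hvTp (hATp h)
  have hvB : v ∉ B := fun h => hvTm (hBTm h)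
  obtain ⟨e1, e2, e3⟩ := card_insert_inter_add_card_union hvA hA hB (hTTp.mono_right hATp)
    (hTTm.mono_right hBTm) hvB hvT
  have hdeg : ∀ x, x ∉ T → P x ∉ M → G.degree x + (insert v (A ∩ B)).card + N ≤ 2 * m ∧
      (2 * m ≤ d + (insert v (A ∩ B)).card + N → ∀ w, w ∉ insert v (A ∩ B) → P w ≠ P x →
        G.Adj x w) := fun x hxT hxM => by
    obtain ⟨h1, h2⟩ := neighborFinset_subset_compl_of_notMem hpart hadj hI hxT hxM
    have h3 := card_le_card h1
    have h4 := card_le_univ (insert v (A ∩ B) ∪ univ.filter fun w => P w = P x)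
    rw [card_compl, h2, card_neighborFinset_eq_degree] at h3
    refine ⟨by omega, fun h5 w hw hwx => ?_⟩
    have h6 := eq_of_subset_of_card_le h1 (by
      rw [card_compl, h2, card_neighborFinset_eq_degree]
      have := hd x
      omega)
    rw [← mem_neighborFinset, h6, mem_compl, mem_union, mem_filter]
    tauto
  obtain ⟨x, hxQ, hxT⟩ := exists_mem_notMem_of_card_lt_card
    (show T.card < (univ.filter fun v => P v ∉ M).card by omega)
  have hdv := hd v
  have hxM := (mem_filter.1 hxQ).2
  have h1 := (hdeg x hxT hxM).1
  have h2 := hd x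
  have hr : 2 ≤ r := by omega
  obtain rfl : h = 2 := by
    by_contra hne
    have : 4 * (r - 1) ≤ (h + 1) * (r - 1) := Nat.mul_le_mul_right _ (by omega)
    omega
  have hfull : ∀ x ∈ univ.filter fun v => P v ∉ M, x ∉ T → ∀ w, w ∉ insert v (A ∩ B) →
      P w ≠ P x → G.Adj x w := fun x hx hxT =>
    (hdeg x hxT (mem_filter.1 hx).2).2 (by omega)
  have hQP : ∀ x w, x ∈ univ.filter (fun v => P v ∉ M) → P w = P x →
      w ∈ univ.filter fun v => P v ∉ M := fun x w hx hw => by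
    rw [mem_filter] at hx ⊢
    exact ⟨mem_univ _, hw ▸ hx.2⟩
  have hQT : ((univ.filter fun v => P v ∉ M) \ T).card < 2 * r := by
    have c1 := card_filter_parts_le hadj hd hI (hMdef ▸ Subset.rfl : M ⊆ _)
    have c2 := card_filter_add_card_filter_not (s := T) fun x => P x ∈ M
    have c3 := card_sdiff_add_card_inter (univ.filter fun v => P v ∉ M) T
    have c4 : (univ.filter fun v => P v ∉ M) ∩ T = T.filter fun x => ¬ P x ∈ M := by
      ext; simp [and_comm]
    rw [c4] at c3
    rw [hM] at c1
    omega
  have hc1 := card_sdiff_add_card_inter A B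
  have hc2 := card_sdiff_add_card_inter B A
  rw [inter_comm] at hc2
  have hc3 : (insert v (A ∩ B)).card = (A ∩ B).card + 1 :=
    card_insert_of_notMem (by simp [hvA])
  have hcov := e3 (by omega)
  have hsub : ∀ S : Finset V, Disjoint T S → v ∉ S → S ⊆ A ∪ B := fun S hS hv w hw =>
    (hcov w (Finset.disjoint_right.1 hS hw)).resolve_left (by rintro rfl; exact hv hw)
  have hdA : ∀ x ∈ A \ B, x ∉ T := fun x hx =>
    Finset.disjoint_right.1 hTTp (hATp (mem_sdiff.1 hx).1)
  have hdB : ∀ x ∈ B \ A, x ∉ T := fun x hx =>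
    Finset.disjoint_right.1 hTTm (hBTm (mem_sdiff.1 hx).1)
  have hxv : x ≠ v := by
    rintro rfl
    exact hxM (mem_image_of_mem P (mem_insert_self _ _))
  rcases mem_union.1 ((hcov x hxT).resolve_left hxv) with hxA | hxB
  · exact false_of_extremal hr hdA hdB (show (A ∪ B).card = m by omega) (by omega) (by omega)
      hATp hBTm (hsub Tp hTTp hvTp) (by omega) hAadj hBadj hfull hQP hQT hvA hvB hxQ hxA hxT
  · exact false_of_extremal hr hdB hdA (show (B ∪ A).card = m by rw [union_comm]; omega)
      (by omega) (by omega) hBTm hATp (by rw [union_comm]; exact hsub Tm hTTm hvTm) (by omega)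
      hBadj hAadj (by rwa [inter_comm B A]) hQP hQT hvB hvA hxQ hxB hxT

theorem false_of_even_of_card_add_two_le (hk : k = 2 * h) (hh : 2 ≤ h) (hm : m = h * N)
    (hmd : m = d + r) (hN : (h + 1) * (r - 1) + 2 ≤ N)
    (hno : ∀ a b, PathOn G a b univ → ¬ G.Adj b a)
    (hpart : ∀ i, (univ.filter fun v => P v = i).card = N) (hadj : ∀ u v, G.Adj u v → P u ≠ P v)
    (hd : ∀ v, d ≤ G.degree v) (hI : ∀ u ∈ I, ∀ x, G.Adj u x → x ∈ T)
    (hM : (I.image P).card = h) (hT : T.card + 2 ≤ m) (hdT : d ≤ T.card)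
    (hIcard : 2 * d + 2 + T.card ≤ I.card + 2 * m) : False := by
  obtain ⟨hPc, hQc⟩ := card_filter_notMem_parts hpart hk hm hM
  set M := I.image P with hMdef
  set X := univ.filter fun v => P v ∈ M with hX
  set Y := univ.filter fun v => P v ∉ M with hY
  have memX : ∀ x, x ∈ X ↔ P x ∈ M := by simp [hX]
  have memY : ∀ x, x ∈ Y ↔ P x ∉ M := by simp [hY]
  have hIX : I ⊆ X := fun u hu => (memX u).2 (mem_image_of_mem P hu)
  have h2N : 2 * N ≤ m := hm ▸ Nat.mul_le_mul_right N hh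
  have hXY : Disjoint X Y := disjoint_filter_filter_not _ _ _
  have hb := card_sdiff_add_card_eq_card hIX
  -- the degree of a vertex splits between the two halves
  have hsplit : ∀ x, d ≤ (X.filter fun u => G.Adj x u).card + (Y.filter fun u => G.Adj x u).card :=
    fun x => by
      refine (hd x).trans ((card_le_card fun w hw => ?_).trans (card_union_le _ _))
      rw [mem_neighborFinset] at hw
      rw [mem_union, mem_filter (s := X), mem_filter (s := Y), memX, memY]
      tauto
  have hsame : ∀ S : Finset (Fin k), S.card = h → ∀ x, P x ∈ S →
      ((univ.filter fun w => P w ∈ S).filter fun u => G.Adj x u).card + N ≤ m := by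
    intro S hS x hx
    have h1 : ((univ.filter fun w => P w ∈ S).filter fun u => G.Adj x u) ⊆
        univ.filter fun w => P w ∈ S.erase (P x) := fun w hw => by
      simp only [mem_filter, mem_univ, true_and, mem_erase] at hw ⊢
      exact ⟨(hadj x w hw.2).symm, hw.1⟩
    have h2 := card_le_card h1
    rw [card_filter_mem_parts hpart, card_erase_of_mem hx, hS] at h2
    have h3 : (h - 1) * N + N = h * N := by
      rw [← Nat.succ_mul, Nat.succ_eq_add_one, Nat.sub_add_cancel (by omega)]
    omega
  have hcompl : (univ.filter fun w => P w ∈ Mᶜ) = Y := by ext; simp [hY]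
  obtain ⟨j, hj, hlow, hcount⟩ := exists_low_degrees hXY (filter_union_filter_not_eq _ _) hPc hQc
    (by omega) hno
  have hjN : N ≤ j + r := by
    rcases hlow with ⟨x, hx, hxj⟩ | ⟨y, hy, hyj⟩
    · have h1 := hsame M hM x ((memX x).1 hx)
      have h2 := hsplit x
      rw [← hX] at h1
      omega
    · have h1 := hsame Mᶜ (by rw [card_compl, Fintype.card_fin, hM]; omega) y
        (by rw [mem_compl]; exact (memY y).1 hy)
      have h2 := hsplit y
      rw [hcompl] at h1
      omega
  have hTX := card_filter_parts_le hadj hd hI (hMdef ▸ Subset.rfl : M ⊆ _)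
  obtain ⟨q, hq⟩ : ∃ q, T.card = d + q := ⟨T.card - d, by omega⟩
  rw [hM, hq, mul_add] at hTX
  have hqr : q + 2 ≤ r := by omega
  have hqh : (h + 1) * (q + 1) ≤ (h + 1) * (r - 1) := Nat.mul_le_mul_left _ (by omega)
  have hIdeg : ∀ u ∈ I, m < (Y.filter fun w => G.Adj u w).card + j := by
    intro u hu
    have h1 := card_filter_parts_le (S := M.erase (P u)) hadj hd hI (erase_subset _ _)
    rw [card_erase_of_mem (mem_image_of_mem P hu), hM, hq, mul_add] at h1
    have h2 : (X.filter fun w => G.Adj u w) ⊆ T.filter fun x => P x ∈ M.erase (P u) :=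
      fun w hw => by
        rw [mem_filter, memX] at hw
        rw [mem_filter, mem_erase]
        exact ⟨hI u hu w hw.2, (hadj u w hw.2).symm, hw.1⟩
    have h3 := card_le_card h2
    have h4 := hsplit u
    have h5 : (h - 1) * q + q = h * q := by
      rw [← Nat.succ_mul, Nat.succ_eq_add_one, Nat.sub_add_cancel (by omega)]
    obtain ⟨s, rfl⟩ : ∃ s, r = q + 2 + s := ⟨r - (q + 2), by omega⟩
    rw [show q + 2 + s - 1 = q + 1 + s by omega] at hN
    have : (h + 1) * (q + 1 + s) = h * q + q + h + 1 + h * s + s := by ring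
    have : 2 * s ≤ h * s := Nat.mul_le_mul_right _ hh
    omega
  have h3r : 3 * (r - 1) ≤ (h + 1) * (r - 1) := Nat.mul_le_mul_right _ (by omega)
  rcases hcount with ⟨hΛ, -⟩ | ⟨-, hlow'⟩
  · set L := X.filter fun x => (Y.filter fun u => G.Adj x u).card ≤ j with hL
    have hLb : L ⊆ X \ I := fun x hx => by
      rw [mem_filter] at hx
      refine mem_sdiff.2 ⟨hx.1, fun hxI => ?_⟩
      have := hIdeg x hxI
      omega
    have hLb' := card_le_card hLb
    have hLX : ∀ z ∈ L, P z ∈ M := fun z hz => (memX z).1 (mem_filter.1 hz).1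
    have hLT := card_sdiff_add_card_inter L T
    have hLT' : (L ∩ T).card ≤ (T.filter fun x => P x ∈ M).card := card_le_card fun x hx => by
      rw [mem_inter] at hx
      exact mem_filter.2 ⟨hx.2, hLX x hx.1⟩
    have hout : ∀ z ∈ L \ T, d ≤ ((X \ I).filter fun w => P w ≠ P z).card + j := fun z hz => by
      rw [mem_sdiff] at hz
      have h1 := hsplit z
      have h2 := (mem_filter.1 hz.1).2
      have h3 := card_le_card (s := X.filter fun u => G.Adj z u)
        (t := (X \ I).filter fun w => P w ≠ P z) fun w hw => by
          rw [mem_filter] at hw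
          rw [mem_filter, mem_sdiff]
          exact ⟨⟨hw.1, fun hwI => hz.2 (hI w hwI z hw.2.symm)⟩, (hadj z w hw.2).symm⟩
      omega
    obtain ⟨z, hz⟩ : (L \ T).Nonempty := card_pos.1 (by
      have : (h + 1) * (q + 1) = h * q + q + h + 1 := by ring
      obtain ⟨s, rfl⟩ : ∃ s, r = q + 2 + s := ⟨r - (q + 2), by omega⟩
      rw [show q + 2 + s - 1 = q + 1 + s by omega] at hN
      have : (h + 1) * (q + 1 + s) = h * q + q + h + 1 + h * s + s := by ring
      omega)
    have hzout := hout z hz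
    have hsp : ((X \ I).filter fun w => P w = P z).card +
        ((X \ I).filter fun w => P w ≠ P z).card = (X \ I).card :=
      card_filter_add_card_filter_not _
    by_cases hh3 : 3 ≤ h
    · have h1 : 3 * N ≤ m := hm ▸ Nat.mul_le_mul_right N hh3
      have h2 : 4 * (r - 1) ≤ (h + 1) * (r - 1) := Nat.mul_le_mul_right _ (by omega)
      omega
    obtain rfl : h = 2 := by omega
    by_cases hsec : ∃ z' ∈ L \ T, P z' ≠ P z
    · obtain ⟨z', hz', hne⟩ := hsec
      have hM2 : M = {P z', P z} := by
        symm
        apply eq_of_subset_of_card_le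
        · intro i hi
          rw [mem_insert, mem_singleton] at hi
          rcases hi with rfl | rfl
          · exact hLX z' (mem_sdiff.1 hz').1
          · exact hLX z (mem_sdiff.1 hz).1
        · rw [hM, card_pair hne]
      have h1 := hout z' hz'
      have h2 := card_le_card (s := (X \ I).filter fun w => P w ≠ P z')
        (t := (X \ I).filter fun w => P w = P z) fun w hw => by
          rw [mem_filter, mem_sdiff, memX, hM2, mem_insert, mem_singleton] at hw
          rw [mem_filter, mem_sdiff, memX]
          refine ⟨⟨?_, hw.1.2⟩, by tauto⟩
          rw [hM2, mem_insert, mem_singleton]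
          exact hw.1.1
      omega
    · push Not at hsec
      have h1 := card_le_card (s := L \ T) (t := (X \ I).filter fun w => P w = P z) fun w hw =>
        mem_filter.2 ⟨hLb (mem_sdiff.1 hw).1, hsec w hw⟩
      omega
  · have h1 := hlow'.trans (card_le_card (t := X \ I) fun x hx => by
      rw [mem_filter] at hx
      refine mem_sdiff.2 ⟨hx.1, fun hxI => ?_⟩
      have := hIdeg x hxI
      omega)
    omega

end Even

section Main

variable {V : Type*} [Fintype V] [DecidableEq V] {G : SimpleGraph V} [DecidableRel G.Adj]
  {k N d : ℕ} {P : V → Fin k}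

theorem false_of_two_parts {P : V → Fin 2} (hN : 2 ≤ N)
    (hpart : ∀ i, (univ.filter fun v => P v = i).card = N) (hadj : ∀ u v, G.Adj u v → P u ≠ P v)
    (hd : ∀ v, d ≤ G.degree v) (hNd : N < 2 * d)
    (hno : ∀ a b, PathOn G a b univ → ¬ G.Adj b a) : False := by
  have hU : (univ.filter fun v => P v = 0) ∪ (univ.filter fun v => P v = 1) = univ := by
    ext v
    simp only [mem_union, mem_filter, mem_univ, true_and, iff_true]
    omega
  have hdis : Disjoint (univ.filter fun v => P v = 0) (univ.filter fun v => P v = 1) := by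
    rw [Finset.disjoint_left]
    simp +contextual
  have hside : ∀ x, ∀ i, P x ≠ i → d ≤ ((univ.filter fun v => P v = i).filter fun u =>
      G.Adj x u).card := fun x i hx => (hd x).trans (card_le_card fun w hw => by
    rw [mem_neighborFinset] at hw
    have := hadj x w hw
    simp only [mem_filter, mem_univ, true_and]
    exact ⟨by omega, hw⟩)
  obtain ⟨j, hj, ⟨x, hx, hxj⟩ | ⟨x, hx, hxj⟩, -⟩ :=
    exists_low_degrees hdis hU (hpart 0) (hpart 1) hN hno
  · have := hside x 1 (by simp [(mem_filter.1 hx).2])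
    omega
  · have := hside x 0 (by simp [(mem_filter.1 hx).2])
    omega

theorem part_bounds {n s : ℕ} (hk : 3 ≤ k) (hn : n = k * N) (hexc : ¬ (k = n / 2 ∧ 4 ∣ n))
    (hr : (n + 1) / 2 = d + s + 1)
    (h : (n : ℤ) + 3 ≤ 2 * (k / 2 + 1 : ℕ) * (N + d - (n + 1) / 2 + 1)) :
    (∀ t, k + 1 = 2 * t → 4 * s + 3 ≤ N) ∧
      (∀ h, k = 2 * h → (h + 1) * s + 2 ≤ N ∧ 2 * s + 3 ≤ N) := by
  have hr' : ((n : ℤ) + 1) / 2 = d + s + 1 := by exact_mod_cast hr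
  rw [hr', show (N : ℤ) + d - (d + s + 1) + 1 = N - s by ring, hn] at h
  constructor
  · intro t ht
    rw [show k / 2 + 1 = t by omega] at h
    have hkt : (k : ℤ) = 2 * t - 1 := by omega
    have h2s : (0 : ℤ) ≤ (t - 2) * s := mul_nonneg (by omega) (by positivity)
    push_cast at h
    rw [hkt] at h
    have : (4 : ℤ) * s + 3 ≤ N := by nlinarith
    exact_mod_cast this
  · intro l hl
    rw [show k / 2 + 1 = l + 1 by omega] at h
    have hkl : (k : ℤ) = 2 * l := by omega
    push_cast at h
    rw [hkl] at h
    have h1 : ((l + 1) * s + 2 : ℤ) ≤ N := by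
      have : (2 : ℤ) * ((l + 1) * s) + 3 ≤ 2 * N := by nlinarith
      omega
    have h1' : (l + 1) * s + 2 ≤ N := by exact_mod_cast h1
    refine ⟨h1', ?_⟩
    have h3s : 3 * s ≤ (l + 1) * s := Nat.mul_le_mul_right _ (by omega)
    by_contra hlt
    obtain rfl : N = 2 := by omega
    omega

theorem false_of_three_le {n : ℕ} (hk : 3 ≤ k) (hn3 : 3 ≤ n) (hn : n = k * N)
    (hcard : Fintype.card V = n) (hexc : ¬ (k = n / 2 ∧ 4 ∣ n))
    (hpart : ∀ i, (univ.filter fun v => P v = i).card = N) (hadj : ∀ u v, G.Adj u v → P u ≠ P v)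
    (hd : ∀ v, d ≤ G.degree v)
    (hbound : (n : ℤ) + 3 ≤ 2 * (k / 2 + 1 : ℕ) * (N + d - (n + 1) / 2 + 1))
    (hno : ∀ a b, PathOn G a b univ → ¬ G.Adj b a) : False := by
  classical
  have h3N : 3 * N ≤ n := hn ▸ Nat.mul_le_mul_right N hk
  obtain ⟨hlarge, h3, h10⟩ : (n ≤ 2 * d ∨ 2 ≤ N ∧ n < 2 * d + N) ∧ n + 2 ≤ 3 * d ∧
      4 * n < 10 * d + 4 := by
    by_cases hnd : n ≤ 2 * d
    · exact ⟨Or.inl hnd, by omega, by omega⟩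
    obtain ⟨s, hs⟩ : ∃ s, (n + 1) / 2 = d + s + 1 := ⟨(n + 1) / 2 - d - 1, by omega⟩
    obtain ⟨hodd, heven⟩ := part_bounds hk hn hexc hs hbound
    obtain ⟨b, hb | hb⟩ := Nat.even_or_odd' k
    · have := heven b hb
      have h4N : 4 * N ≤ n := hn ▸ Nat.mul_le_mul_right N (by omega)
      have h3s : 3 * s ≤ (b + 1) * s := Nat.mul_le_mul_right _ (by omega)
      exact ⟨Or.inr ⟨by omega, by omega⟩, by omega, by omega⟩
    · have := hodd (b + 1) (by omega)
      exact ⟨Or.inr ⟨by omega, by omega⟩, by omega, by omega⟩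
  -- a longest cycle, degenerate cycles of length two being allowed
  obtain ⟨S, hS, hSmax⟩ := exists_max_image
    (univ.filter fun S : Finset V => ∃ a b, PathOn G a b S ∧ G.Adj b a) card (by
      obtain ⟨x⟩ : Nonempty V := Fintype.card_pos_iff.1 (by omega)
      obtain ⟨y, hy⟩ : (G.neighborFinset x).Nonempty := card_pos.1 (by
        rw [card_neighborFinset_eq_degree]
        have := hd x
        omega)
      rw [mem_neighborFinset] at hy
      exact ⟨insert x {y}, mem_filter.2 ⟨mem_univ _, x, y,
        PathOn.cons hy (PathOn.single y) (by simp [hy.ne]), hy.symm⟩⟩)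
  obtain ⟨a, b, p, hab⟩ := (mem_filter.1 hS).2
  obtain ⟨F, hF, hFS⟩ := p.exists_isCyc hab
  obtain ⟨v, hvS⟩ : ∃ v, v ∉ S := by
    by_contra! h
    rw [eq_univ_of_forall h] at p
    exact hno a b p hab
  have hmax : ∀ a b S', PathOn G a b S' → G.Adj b a → S'.card ≤ S.card := fun a b S' p h =>
    hSmax S' (mem_filter.2 ⟨mem_univ _, a, b, p, h⟩)
  have hcut := exists_adj_of_cut hpart hadj hd (by rwa [hcard])
  obtain ⟨T, A, B, Tp, Tm, hI, hA, hB, hATp, hBTm, hTp, hTm, hTTp, hTTm, hvT, hvTp, hvTm, hAadj,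
      hBadj⟩ := hF.exists_shift_structure (v := v) hmax (fun i h => hvS (h ▸ hFS i))
    fun F' hF' x y hx hy => hF'.not_adj_of_longest hmax hcut hd (by rwa [hcard]) (by rwa [hcard])
      hx hy
  obtain ⟨e1, e2, -⟩ := card_insert_inter_add_card_union (fun h => hvTp (hATp h)) hA hB
    (hTTp.mono_right hATp) (hTTm.mono_right hBTm) (fun h => hvTm (hBTm h)) hvT
  have hdv := hd v
  have hvdeg : G.degree v ≤ T.card := card_le_card fun w hw =>
    hI v (mem_insert_self _ _) w ((mem_neighborFinset _ _ _).1 hw)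
  have hT := card_lt_univ_of_notMem (s := T ∪ Tp) (x := v) (by simp [hvT, hvTp])
  rw [card_union_of_disjoint hTTp] at hT
  obtain ⟨s, hs⟩ : ∃ s, (n + 1) / 2 = d + s + 1 := ⟨(n + 1) / 2 - d - 1, by omega⟩
  obtain ⟨hodd, heven⟩ := part_bounds hk hn hexc hs hbound
  have hbound' : Fintype.card V + 3 ≤
      2 * ((k / 2 + 1 : ℕ) : ℤ) * (N + d - ((n + 1) / 2 : ℕ) + 1) := by
    rw [hcard]
    exact_mod_cast hbound
  have hM := card_image_parts_lt hpart hadj hd hI (by omega) (by omega) hbound'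
  obtain ⟨h, hh | hh⟩ := Nat.even_or_odd' k
  · obtain ⟨hN1, hN2⟩ := heven h hh
    obtain ⟨m, hm⟩ : ∃ m, m = h * N := ⟨_, rfl⟩
    have hnm : n = 2 * m := by rw [hn, hh, hm, mul_assoc]
    have h3s : 3 * s ≤ (h + 1) * s := Nat.mul_le_mul_right _ (by omega)
    have hMh : ((insert v (A ∩ B)).image P).card = h := by
      by_contra hne
      have h1 := card_le_card (s := insert v (A ∩ B))
        (t := univ.filter fun x => P x ∈ (insert v (A ∩ B)).image P) fun x hx =>
          mem_filter.2 ⟨mem_univ _, mem_image_of_mem P hx⟩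
      rw [card_filter_mem_parts hpart] at h1
      have h2 : (((insert v (A ∩ B)).image P).card + 1) * N ≤ h * N :=
        Nat.mul_le_mul_right _ (by omega)
      rw [add_mul] at h2
      omega
    by_cases hTm1 : T.card + 1 = m
    · exact false_of_even_of_card_add_one_eq hh (by omega) hm (by omega)
        (show m = d + (s + 1) by omega) (by simpa using hN1) (by omega) hpart hadj hd hI hMh hTm1
        hA hB hATp hBTm hTp hTm hTTp hTTm hvT hvTp hvTm hAadj hBadj
    · exact false_of_even_of_card_add_two_le hh (by omega) hm
        (show m = d + (s + 1) by omega) (by simpa using hN1) hno hpart hadj hd hI hMh (by omega)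
        (by omega) (by omega)
  · have hN := hodd (h + 1) (by omega)
    exact false_of_odd (t := k / 2 + 1) (C := (n + 1) / 2) (by omega) (hcard.trans hn) hpart hadj hd
      hI (by omega) (by omega) (by omega) (by omega) hbound' (by omega)

end Main

/-- **Theorem (DeBiasio–Spanier).** For `k ≥ 2`, any balanced `k`-partite graph on `n ≥ 3`
vertices with minimum degree at least `⌈n/2⌉ + ⌊(n+2)/(2⌈(k+1)/2⌉)⌋ − n/k` has a Hamiltonian
cycle, unless `k = 2` and `4 ∣ n`, or `k = n/2` and `4 ∣ n`. -/
theorem balanced_kpartite_hamiltonian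
    {V : Type*} [Fintype V] [DecidableEq V] (G : SimpleGraph V) [DecidableRel G.Adj]
    (k n : ℕ) (hk : 2 ≤ k) (hn : 3 ≤ n) (hcard : Fintype.card V = n) (hdvd : k ∣ n)
    (hG : IsBalancedKPartite G k)
    (hδ : degBound n k ≤ (G.minDegree : ℚ))
    (hexc : ¬ ((k = 2 ∧ 4 ∣ n) ∨ (k = n / 2 ∧ 4 ∣ n))) :
    G.IsHamiltonian := by
  obtain ⟨P, hpart, hadj⟩ := hG
  obtain ⟨N, hnN⟩ := hdvd
  rw [hcard, hnN, Nat.mul_div_cancel_left N (by omega)] at hpart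
  have hbound := add_three_le_of_degBound_le (by omega) hnN hδ
  by_contra hH
  have hno : ∀ a b, PathOn G a b univ → ¬ G.Adj b a := fun a b p h =>
    hH (p.isHamiltonian h (by omega))
  rcases hk.eq_or_lt with rfl | hk3
  · refine false_of_two_parts (by omega) hpart hadj G.minDegree_le_degree ?_ hno
    omega
  · exact false_of_three_le hk3 hn hnN hcard (fun h => hexc (Or.inr h)) hpart hadj
      G.minDegree_le_degree hbound hno
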